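/- Let D and D' be division rings with |D| ≥ 4, and let m, n, m', n' ≥ 2 be integers with m' ≥ m and n' ≥ n. Suppose θ: D^{m×n} → D'^{m'×n'} is a non-degenerate graph homomorphism with θ(0) = 0 such that θ(M_i) ⊆ M'_i for i = 1, …, m and θ(N_j) ⊆ N'_j for j = 1, …, n. Then there exist invertible diagonal matrices P ∈ GL_{m'}(D') and Q ∈ GL_{n'}(D'), a nonzero ring homomorphism τ: D → D', and a matrix L ∈ D'^{n×m} such that I_m + X^τ·L is invertible for every X ∈ D^{m×n} and θ(X) = P · diag((I_m + X^τ·L)^{-1}·X^τ, 0) · Q for all X ∈ D^{m×n}. In particular, if τ is surjective then L = 0 and τ is a ring isomorphism. Here X^τ denotes applying τ entrywise. -/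

import Mathlib

open Matrix

/-- Rank of a matrix over a division ring: dimension of the left row space. -/
noncomputable def mrank {D : Type} [DivisionRing D] {m n : ℕ} (A : Matrix (Fin m) (Fin n) D) : ℕ :=
  Module.finrank D (Submodule.span D (Set.range fun i : Fin m => fun j : Fin n => A i j))

/-- The standard maximal set of type one: matrices whose rows other than the first are zero. -/
def M1set (D : Type) [DivisionRing D] (m n : ℕ) : Set (Matrix (Fin m) (Fin n) D) :=
  {X | ∀ i j, i.val ≠ 0 → X i j = 0}

/-- The standard maximal set of type two: matrices whose columns other than the first are zero. -/
def N1set (D : Type) [DivisionRing D] (m n : ℕ) : Set (Matrix (Fin m) (Fin n) D) :=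
  {X | ∀ i j, j.val ≠ 0 → X i j = 0}

/-- A maximal set of type one: a set of the form `P·M₁ + A` with `P` invertible. -/
def IsTypeOne {D : Type} [DivisionRing D] {m n : ℕ} (S : Set (Matrix (Fin m) (Fin n) D)) : Prop :=
  ∃ P : Matrix (Fin m) (Fin m) D, ∃ A : Matrix (Fin m) (Fin n) D,
    IsUnit P ∧ S = (fun X => P * X + A) '' M1set D m n

/-- A maximal set of type two: a set of the form `N₁·Q + A` with `Q` invertible. -/
def IsTypeTwo {D : Type} [DivisionRing D] {m n : ℕ} (S : Set (Matrix (Fin m) (Fin n) D)) : Prop :=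
  ∃ Q : Matrix (Fin n) (Fin n) D, ∃ A : Matrix (Fin m) (Fin n) D,
    IsUnit Q ∧ S = (fun X => X * Q + A) '' N1set D m n

/-- A maximal set (maximal clique of the adjacency graph): of type one or type two. -/
def IsMaximalSet {D : Type} [DivisionRing D] {m n : ℕ}
    (S : Set (Matrix (Fin m) (Fin n) D)) : Prop :=
  IsTypeOne S ∨ IsTypeTwo S

/-- A graph homomorphism `φ` is degenerate if there is a matrix `A` of rank at most one and two
maximal sets of different types `Ms`, `Ns` in the target with `φ A ∈ Ms ∩ Ns` and the image of
the unit ball around `A` contained in `Ms ∪ Ns`. -/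
def Degenerate {D D' : Type} [DivisionRing D] [DivisionRing D'] {m n m' n' : ℕ}
    (φ : Matrix (Fin m) (Fin n) D → Matrix (Fin m') (Fin n') D') : Prop :=
  ∃ A : Matrix (Fin m) (Fin n) D, mrank A ≤ 1 ∧
    ∃ Ms Ns : Set (Matrix (Fin m') (Fin n') D'),
      IsTypeOne Ms ∧ IsTypeTwo Ns ∧ φ A ∈ Ms ∩ Ns ∧
      φ '' {X | mrank (X - A) ≤ 1} ⊆ Ms ∪ Ns

/-- Embed a matrix `Y` as the upper-left block `diag(Y, 0)` of a (possibly) larger matrix. -/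
def embedM {R : Type} [Zero R] {a b a' b' : ℕ} (Y : Matrix (Fin a) (Fin b) R) :
    Matrix (Fin a') (Fin b') R :=
  Matrix.of fun i j => if h : i.val < a ∧ j.val < b then Y ⟨i.val, h.1⟩ ⟨j.val, h.2⟩ else 0

/-- The maximal set `M_i`: matrices whose rows other than the `i`-th are zero. -/
def rowSet (D : Type) [DivisionRing D] (m n : ℕ) (i : Fin m) :
    Set (Matrix (Fin m) (Fin n) D) :=
  {X | ∀ a j, a ≠ i → X a j = 0}

/-- The maximal set `N_j`: matrices whose columns other than the `j`-th are zero. -/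
def colSet (D : Type) [DivisionRing D] (m n : ℕ) (j : Fin n) :
    Set (Matrix (Fin m) (Fin n) D) :=
  {X | ∀ i b, b ≠ j → X i b = 0}

section Lineation

variable {D D' : Type*} [DivisionRing D'] [DivisionRing D]

/-- The functional equation satisfied by the intercepts of the images of lines under a lineation
of the plane forces the intercepts, in inverse coordinates, to be affine over a ring
homomorphism. -/
theorem exists_ringHom_of_intercepts (hD : ∀ a b c : D, ∃ d, d ≠ a ∧ d ≠ b ∧ d ≠ c)
    (A B A₀ B₀ e : D → D') (C : D → D → D')
    (he : ∀ d d', d ≠ 0 → d' ≠ 0 → e d = e d' → d = d')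
    (he0 : ∀ d, d ≠ 0 → e d ≠ 0)
    (hB : ∀ d d', d ≠ 0 → d' ≠ 0 → B d = B d' → d = d')
    (hC : ∀ d s t, d ≠ 0 → s ≠ 0 → t ≠ 0 → t + d * s ≠ 0 → B t + e d * A s = C d (t + d * s))
    (hA₀ : ∀ d t, d ≠ 0 → t ≠ 0 → B t + e d * A₀ t = C d t)
    (hB₀ : ∀ d s, d ≠ 0 → s ≠ 0 → B₀ s + e d * A s = C d (d * s)) :
    ∃ (τ : D →+* D') (p q l l' : D'), p ≠ 0 ∧ q ≠ 0 ∧ (∀ s, s ≠ 0 → A s = p * τ s + l) ∧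
      (∀ t, t ≠ 0 → B t = q * τ t + l') ∧ (∀ d, d ≠ 0 → e d = q * τ d * p⁻¹) ∧
      ∀ d c, d ≠ 0 → c ≠ 0 → C d c = q * τ c + l' + e d * l := by
  obtain ⟨d₂, hd₂0, hd₂1, -⟩ := hD 0 1 1
  have he12 : e d₂ - e 1 ≠ 0 := fun h => hd₂1 (he _ _ hd₂0 one_ne_zero (sub_eq_zero.1 h))
  have hA₀c : ∀ t, t ≠ 0 → A₀ t = A₀ 1 := by
    intro t ht
    obtain ⟨w, hw0, hwt, hw1⟩ := hD 0 t 1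
    have key : ∀ d, d ≠ 0 → e d * (A₀ t - A₀ 1) = (B (t - w) - B t) - (B (1 - w) - B 1) := by
      intro d hd
      have hs : d⁻¹ * w ≠ 0 := mul_ne_zero (inv_ne_zero hd) hw0
      have hds : d * (d⁻¹ * w) = w := mul_inv_cancel_left₀ hd w
      have h1 := hC d (d⁻¹ * w) (t - w) hd hs (sub_ne_zero.2 hwt.symm) (by simpa [hds] using ht)
      have h2 := hC d (d⁻¹ * w) (1 - w) hd hs (sub_ne_zero.2 hw1.symm) (by simp [hds])
      rw [hds, sub_add_cancel] at h1 h2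
      have h3 := hA₀ d t hd ht
      have h4 := hA₀ d 1 hd one_ne_zero
      rw [← h1] at h3
      rw [← h2] at h4
      rw [mul_sub]
      linear_combination (norm := abel) h3 - h4
    have h := (key d₂ hd₂0).trans (key 1 one_ne_zero).symm
    rw [← sub_eq_zero, ← sub_mul] at h
    exact sub_eq_zero.1 ((mul_eq_zero.1 h).resolve_left he12)
  have hB₀c : ∀ s, s ≠ 0 → B₀ s = B₀ 1 := by
    intro s hs
    obtain ⟨w, hw0, hws, hw1⟩ := hD 0 s 1
    have key : ∀ d, d ≠ 0 → B₀ s - B₀ 1 = e d * ((A (s - w) - A s) - (A (1 - w) - A 1)) := by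
      intro d hd
      have hdw : d * w ≠ 0 := mul_ne_zero hd hw0
      have e1 : d * w + d * (s - w) = d * s := by rw [← mul_add]; congr 1; abel
      have e2 : d * w + d * (1 - w) = d * 1 := by rw [← mul_add]; congr 1; abel
      have h1 := hC d (s - w) (d * w) hd (sub_ne_zero.2 hws.symm) hdw
        (by rw [e1]; exact mul_ne_zero hd hs)
      have h2 := hC d (1 - w) (d * w) hd (sub_ne_zero.2 hw1.symm) hdw
        (by rw [e2]; exact mul_ne_zero hd one_ne_zero)
      rw [e1, ← hB₀ d s hd hs] at h1
      rw [e2, ← hB₀ d 1 hd one_ne_zero] at h2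
      rw [mul_sub, mul_sub, mul_sub]
      linear_combination (norm := abel) h2 - h1
    have h := (key d₂ hd₂0).symm.trans (key 1 one_ne_zero)
    rw [← sub_eq_zero, ← sub_mul] at h
    rw [← sub_eq_zero, key 1 one_ne_zero, (mul_eq_zero.1 h).resolve_left he12, mul_zero]
  classical
  set A' : D → D' := fun s => if s = 0 then A₀ 1 else A s with hA'
  set B' : D → D' := fun s => if s = 0 then B₀ 1 else B s with hB'
  have K : ∀ d s t, d ≠ 0 → t + d * s ≠ 0 → B' t + e d * A' s = C d (t + d * s) := by
    intro d s t hd hts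
    by_cases hs : s = 0
    · subst hs
      have ht : t ≠ 0 := by simpa using hts
      simpa [hA', hB', ht, hA₀c t ht] using hA₀ d t hd ht
    · by_cases ht : t = 0
      · subst ht
        simpa [hA', hB', hs, hB₀c s hs] using hB₀ d s hd hs
      · simpa [hA', hB', hs, ht] using hC d s t hd hs ht hts
  have shift : ∀ t t' w, t ≠ 0 → t' ≠ 0 → B' (t - w) - B' (t' - w) = B' t - B' t' := by
    intro t t' w ht ht'
    have h1 := K 1 w (t - w) one_ne_zero (by simpa using ht)
    have h2 := K 1 w (t' - w) one_ne_zero (by simpa using ht')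
    have h3 := K 1 0 t one_ne_zero (by simpa using ht)
    have h4 := K 1 0 t' one_ne_zero (by simpa using ht')
    simp only [one_mul, sub_add_cancel, add_zero] at h1 h2 h3 h4
    linear_combination (norm := abel) h1 - h2 - h3 + h4
  have hadd : ∀ x y, B' (x + y) - B' y = B' x - B' 0 := by
    intro x y
    obtain ⟨z, hz0, hzx, -⟩ := hD 0 (-x) 0
    have hxz : x + z ≠ 0 := fun h => hzx (eq_neg_of_add_eq_zero_right h)
    have h1 := shift (x + z) z z hxz hz0
    have h2 := shift (x + z) z (z - y) hxz hz0
    rw [add_sub_cancel_right, sub_self] at h1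
    rw [show x + z - (z - y) = x + y by abel, show z - (z - y) = y by abel] at h2
    rw [h1, h2]
  have hβ : ∀ d s, d ≠ 0 → B' (d * s) - B' 0 = e d * (A' s - A' 0) := by
    intro d s hd
    obtain ⟨t, ht0, hts, -⟩ := hD 0 (-(d * s)) 0
    have h0 : t + d * s ≠ 0 := fun h => hts (eq_neg_of_add_eq_zero_left h)
    have h1 := K d s t hd h0
    have h2 := K d 0 (t + d * s) hd (by simpa using h0)
    have h3 := hadd (d * s) t
    rw [mul_zero, add_zero] at h2
    rw [add_comm] at h3
    rw [mul_sub]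
    linear_combination (norm := abel) h2 - h1 - h3
  set p := A' 1 - A' 0 with hp
  set q := B' 1 - B' 0 with hq
  have hβ1 : ∀ d, d ≠ 0 → B' d - B' 0 = e d * p := fun d hd => by simpa using hβ d 1 hd
  have hp0 : p ≠ 0 := by
    intro h
    have h1 := hβ1 1 one_ne_zero
    have h2 := hβ1 d₂ hd₂0
    rw [h, mul_zero, sub_eq_zero] at h1 h2
    have h3 := h1.trans h2.symm
    simp only [hB', one_ne_zero, hd₂0, if_false] at h3
    exact hd₂1 (hB _ _ one_ne_zero hd₂0 h3).symm
  have hqe : q = e 1 * p := hβ1 1 one_ne_zero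
  have hq0 : q ≠ 0 := by rw [hqe]; exact mul_ne_zero (he0 1 one_ne_zero) hp0
  have hBτ : ∀ s, B' s - B' 0 = e 1 * (A' s - A' 0) := fun s => by
    simpa using hβ 1 s one_ne_zero
  let τ : D →+* D' :=
    { toFun := fun s => p⁻¹ * (A' s - A' 0)
      map_one' := inv_mul_cancel₀ hp0
      map_zero' := by simp
      map_add' := by
        intro x y
        have h := hadd x y
        have h1 := hBτ (x + y)
        have h2 := hBτ x
        have h3 := hBτ y
        rw [← mul_add]
        congr 1
        apply mul_left_cancel₀ (he0 1 one_ne_zero)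
        rw [mul_add, ← h1, ← h2, ← h3, ← h]
        abel
      map_mul' := by
        intro x y
        by_cases hx : x = 0
        · simp [hx]
        have h1 := hβ x y hx
        rw [hBτ] at h1
        have h2 := hβ1 x hx
        rw [hBτ] at h2
        have h3 : e x = e 1 * (A' x - A' 0) * p⁻¹ := by rw [h2, mul_inv_cancel_right₀ hp0]
        rw [h3] at h1
        simp only [mul_assoc] at h1 ⊢
        rw [mul_left_cancel₀ (he0 1 one_ne_zero) h1] }
  have hτ : ∀ s, p * τ s = A' s - A' 0 := fun s => mul_inv_cancel_left₀ hp0 _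
  have hqτ : ∀ s, q * τ s = B' s - B' 0 := fun s => by rw [hqe, mul_assoc, hτ, hBτ]
  refine ⟨τ, p, q, A' 0, B' 0, hp0, hq0, ?_, ?_, ?_, ?_⟩
  · intro s hs
    rw [hτ, sub_add_cancel]
    simp [hA', hs]
  · intro s hs
    rw [hqτ, sub_add_cancel]
    simp [hB', hs]
  · intro d hd
    rw [hqτ, hβ1 d hd, mul_inv_cancel_right₀ hp0]
  · intro d c hd hc
    rw [hqτ, sub_add_cancel]
    simpa using (K d 0 c hd (by simpa using hc)).symm

/-- A lineation of the plane preserving the two axes is projective, in coordinates. -/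
theorem exists_ringHom_of_plane_coordinates
    (hD : ∀ a b c : D, ∃ d, d ≠ a ∧ d ≠ b ∧ d ≠ c) (X Y : D → D → D')
    (hinj : ∀ x y x' y', X x y = X x' y' → Y x y = Y x' y' → x = x' ∧ y = y')
    (hlin : ∀ x y x' y' r, ∃ ρ,
      X (x + r * (x' - x)) (y + r * (y' - y)) = X x y + ρ * (X x' y' - X x y) ∧
      Y (x + r * (x' - x)) (y + r * (y' - y)) = Y x y + ρ * (Y x' y' - Y x y))
    (hX0 : ∀ y, X 0 y = 0) (hY0 : ∀ x, Y x 0 = 0) :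
    ∃ (τ : D →+* D') (u v w w' : D'), u ≠ 0 ∧ v ≠ 0 ∧ ∀ x y, 1 + τ x * w + τ y * w' ≠ 0 ∧
      X x y = (1 + τ x * w + τ y * w')⁻¹ * (τ x * u) ∧
      Y x y = (1 + τ x * w + τ y * w')⁻¹ * (τ y * v) := by
  have hXx : ∀ x, x ≠ 0 → X x 0 ≠ 0 := fun x hx h =>
    hx (hinj x 0 0 0 (by rw [h, hX0]) (by rw [hY0, hY0])).1
  have hYy : ∀ y, y ≠ 0 → Y 0 y ≠ 0 := fun y hy h =>
    hy (hinj 0 y 0 0 (by rw [hX0, hX0]) (by rw [h, hY0])).2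
  have hline : ∀ x y x' y' r a b, X x y * a + Y x y * b = 1 → X x' y' * a + Y x' y' * b = 1 →
      X (x + r * (x' - x)) (y + r * (y' - y)) * a +
        Y (x + r * (x' - x)) (y + r * (y' - y)) * b = 1 := by
    intro x y x' y' r a b h1 h2
    obtain ⟨ρ, hρ, hρ'⟩ := hlin x y x' y' r
    rw [hρ, hρ']
    have h3 : (X x' y' - X x y) * a + (Y x' y' - Y x y) * b = 0 := by
      rw [sub_mul, sub_mul]
      linear_combination (norm := abel) h2 - h1
    rw [add_mul, add_mul, mul_assoc, mul_assoc, add_add_add_comm, h1, ← mul_add, h3, mul_zero,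
      add_zero]
  set A : D → D' := fun s => (X s⁻¹ 0)⁻¹ with hA
  set B : D → D' := fun t => (Y 0 t⁻¹)⁻¹ with hB
  have hXA : ∀ s, s ≠ 0 → X s⁻¹ 0 * A s = 1 := fun s hs =>
    mul_inv_cancel₀ (hXx _ (inv_ne_zero hs))
  have hYB : ∀ t, t ≠ 0 → Y 0 t⁻¹ * B t = 1 := fun t ht =>
    mul_inv_cancel₀ (hYy _ (inv_ne_zero ht))
  have H1 : ∀ x y s t, s ≠ 0 → t ≠ 0 → x * s + y * t = 1 → X x y * A s + Y x y * B t = 1 := by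
    intro x y s t hs ht h
    have h1 := hline s⁻¹ 0 0 t⁻¹ (y * t) (A s) (B t) (by rw [hY0, hXA s hs, zero_mul, add_zero])
      (by rw [hX0, hYB t ht, zero_mul, zero_add])
    have e1 : s⁻¹ + y * t * (0 - s⁻¹) = x := by
      rw [← eq_sub_iff_add_eq] at h
      rw [zero_sub, mul_neg, ← sub_eq_add_neg]
      nth_rewrite 1 [← one_mul s⁻¹]
      rw [← sub_mul, ← h, mul_inv_cancel_right₀ hs]
    have e2 : 0 + y * t * (t⁻¹ - 0) = y := by
      rw [zero_add, sub_zero, mul_inv_cancel_right₀ ht]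
    rwa [e1, e2] at h1
  have H2 : ∀ x y, x ≠ 0 → y ≠ 0 → X x y ≠ 0 ∧ Y x y ≠ 0 := by
    intro x y hx hy
    obtain ⟨s, hs0, hsx, -⟩ := hD 0 x⁻¹ 0
    have ht : y⁻¹ * (1 - x * s) ≠ 0 := by
      refine mul_ne_zero (inv_ne_zero hy) (sub_ne_zero.2 fun h => hsx ?_)
      exact (inv_eq_of_mul_eq_one_right h.symm).symm
    have h := H1 x y s _ hs0 ht (by rw [mul_inv_cancel_left₀ hy]; abel)
    constructor
    · intro h0
      rw [h0, zero_mul, zero_add] at h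
      refine hx (hinj x y 0 (y⁻¹ * (1 - x * s))⁻¹ (by rw [h0, hX0]) ?_).1
      rw [eq_inv_of_mul_eq_one_left h, hB, inv_inv]
    · intro h0
      rw [h0, zero_mul, add_zero] at h
      refine hy (hinj x y s⁻¹ 0 ?_ (by rw [h0, hY0])).2
      rw [eq_inv_of_mul_eq_one_left h, hA, inv_inv]
  set e : D → D' := fun d => (Y d 1)⁻¹ * X d 1 with he
  have H3 : ∀ x y, x ≠ 0 → y ≠ 0 → X x y = Y x y * e (y⁻¹ * x) := by
    intro x y hx hy
    obtain ⟨ρ, hρ, hρ'⟩ := hlin 0 0 (y⁻¹ * x) 1 y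
    simp only [sub_zero, zero_add, mul_inv_cancel_left₀ hy, hX0, hY0, mul_one] at hρ hρ'
    rw [hρ, hρ', mul_assoc, he,
      mul_inv_cancel_left₀ (H2 _ _ (mul_ne_zero (inv_ne_zero hy) hx) one_ne_zero).2]
  set C : D → D → D' := fun d c => (Y (c⁻¹ * d) c⁻¹)⁻¹ with hC
  have H4 : ∀ d c a b, d ≠ 0 → c ≠ 0 → X (c⁻¹ * d) c⁻¹ * a + Y (c⁻¹ * d) c⁻¹ * b = 1 →
      b + e d * a = C d c := by
    intro d c a b hd hc h
    rw [H3 _ _ (mul_ne_zero (inv_ne_zero hc) hd) (inv_ne_zero hc), inv_inv,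
      mul_inv_cancel_left₀ hc, mul_assoc, ← mul_add, add_comm] at h
    exact (inv_eq_of_mul_eq_one_right h).symm
  have H5 : ∀ d c a b, d ≠ 0 → c ≠ 0 → b + e d * a = C d c →
      X (c⁻¹ * d) c⁻¹ * a + Y (c⁻¹ * d) c⁻¹ * b = 1 := by
    intro d c a b hd hc h
    rw [H3 _ _ (mul_ne_zero (inv_ne_zero hc) hd) (inv_ne_zero hc), inv_inv,
      mul_inv_cancel_left₀ hc, mul_assoc, ← mul_add, add_comm, h]
    exact mul_inv_cancel₀ (H2 _ _ (mul_ne_zero (inv_ne_zero hc) hd) (inv_ne_zero hc)).2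
  have hCC : ∀ d s t, d ≠ 0 → s ≠ 0 → t ≠ 0 → t + d * s ≠ 0 →
      B t + e d * A s = C d (t + d * s) := by
    intro d s t hd hs ht hc
    refine H4 _ _ _ _ hd hc (H1 _ _ _ _ hs ht ?_)
    rw [mul_assoc, ← mul_add, add_comm (d * s), inv_mul_cancel₀ hc]
  have he0 : ∀ d, d ≠ 0 → e d ≠ 0 := fun d hd =>
    mul_ne_zero (inv_ne_zero (H2 _ _ hd one_ne_zero).2) (H2 _ _ hd one_ne_zero).1
  obtain ⟨τ, p, q, l, l', hp, hq, hAτ, hBτ, heτ, hCτ⟩ :=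
    exists_ringHom_of_intercepts hD A B (fun t => (e 1)⁻¹ * (C 1 t - B t))
      (fun s => C 1 s - e 1 * A s) e C
      (by
        intro d d' hd hd' h
        obtain ⟨t, ht, htd, htd'⟩ := hD 0 (-d) (-d')
        have hc : t + d * 1 ≠ 0 := fun h => htd (by
          rw [mul_one] at h; exact eq_neg_of_add_eq_zero_left h)
        have hc' : t + d' * 1 ≠ 0 := fun h => htd' (by
          rw [mul_one] at h; exact eq_neg_of_add_eq_zero_left h)
        have h1 := hCC d 1 t hd one_ne_zero ht hc
        have h2 := hCC d' 1 t hd' one_ne_zero ht hc'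
        rw [← h, h1] at h2
        have hY := inv_injective h2
        have hX : X ((t + d * 1)⁻¹ * d) (t + d * 1)⁻¹ = X ((t + d' * 1)⁻¹ * d') (t + d' * 1)⁻¹ := by
          rw [H3 _ _ (mul_ne_zero (inv_ne_zero hc) hd) (inv_ne_zero hc),
            H3 _ _ (mul_ne_zero (inv_ne_zero hc') hd') (inv_ne_zero hc'), inv_inv, inv_inv,
            mul_inv_cancel_left₀ hc, mul_inv_cancel_left₀ hc', hY, h]
        have h3 := (hinj _ _ _ _ hX hY).2
        have h4 := inv_injective h3
        rw [mul_one, mul_one] at h4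
        exact add_left_cancel h4)
      he0
      (by
        intro d d' hd hd' h
        exact inv_injective (hinj _ _ _ _ (by rw [hX0, hX0]) (inv_injective h)).2)
      hCC
      (by
        intro d t hd ht
        refine H4 _ _ _ _ hd ht ?_
        have h1 := hline 0 t⁻¹ t⁻¹ t⁻¹ (t⁻¹ * d * t) ((e 1)⁻¹ * (C 1 t - B t)) (B t)
          (by rw [hX0, hYB t ht, zero_mul, zero_add])
          (by
            have := H5 1 t ((e 1)⁻¹ * (C 1 t - B t)) (B t) one_ne_zero ht
              (by rw [mul_inv_cancel_left₀ (he0 1 one_ne_zero)]; abel)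
            rwa [mul_one] at this)
        rwa [sub_zero, zero_add, mul_inv_cancel_right₀ ht, sub_self, mul_zero, add_zero] at h1)
      (by
        intro d s hd hs
        refine H4 _ _ _ _ hd (mul_ne_zero hd hs) ?_
        have h1 := hline s⁻¹ 0 s⁻¹ s⁻¹ (s⁻¹ * d⁻¹ * s) (A s) (C 1 s - e 1 * A s)
          (by rw [hY0, hXA s hs, zero_mul, add_zero])
          (by
            have := H5 1 s (A s) (C 1 s - e 1 * A s) one_ne_zero hs (by abel)
            rwa [mul_one] at this)
        rw [sub_zero, zero_add, mul_inv_cancel_right₀ hs, sub_self, mul_zero, add_zero] at h1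
        rwa [_root_.mul_inv_rev, inv_mul_cancel_right₀ hd])
  have hτ : ∀ x, x ≠ 0 → τ x ≠ 0 := fun x hx => (map_ne_zero τ).2 hx
  refine ⟨τ, p⁻¹, q⁻¹, p⁻¹ * l, q⁻¹ * l', inv_ne_zero hp, inv_ne_zero hq, fun x y => ?_⟩
  by_cases hx : x = 0
  · by_cases hy : y = 0
    · simp [hx, hy, hX0, hY0]
    · have h1 := hBτ y⁻¹ (inv_ne_zero hy)
      have h2 : B y⁻¹ ≠ 0 := inv_ne_zero (by rw [inv_inv]; exact hYy y hy)
      have h3 : B y⁻¹ = q * (τ y)⁻¹ * (1 + τ y * (q⁻¹ * l')) := by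
        rw [h1, mul_add, mul_one, mul_assoc, inv_mul_cancel_left₀ (hτ y hy),
          mul_inv_cancel_left₀ hq, map_inv₀]
      have h4 : Y 0 y = (B y⁻¹)⁻¹ := by rw [hB, inv_inv, inv_inv]
      subst hx
      rw [map_zero, zero_mul, add_zero, zero_mul, mul_zero, hX0]
      refine ⟨fun h => h2 (by rw [h3, h, mul_zero]), rfl, ?_⟩
      rw [h4, h3, _root_.mul_inv_rev, _root_.mul_inv_rev, inv_inv]
  · by_cases hy : y = 0
    · have h1 := hAτ x⁻¹ (inv_ne_zero hx)
      have h2 : A x⁻¹ ≠ 0 := inv_ne_zero (by rw [inv_inv]; exact hXx x hx)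
      have h3 : A x⁻¹ = p * (τ x)⁻¹ * (1 + τ x * (p⁻¹ * l)) := by
        rw [h1, mul_add, mul_one, mul_assoc, inv_mul_cancel_left₀ (hτ x hx),
          mul_inv_cancel_left₀ hp, map_inv₀]
      have h4 : X x 0 = (A x⁻¹)⁻¹ := by rw [hA, inv_inv, inv_inv]
      subst hy
      rw [map_zero, zero_mul, add_zero, zero_mul, mul_zero, hY0]
      refine ⟨fun h => h2 (by rw [h3, h, mul_zero]), ?_, rfl⟩
      rw [h4, h3, _root_.mul_inv_rev, _root_.mul_inv_rev, inv_inv]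
    · have hd : y⁻¹ * x ≠ 0 := mul_ne_zero (inv_ne_zero hy) hx
      have h1 := hCτ (y⁻¹ * x) y⁻¹ hd (inv_ne_zero hy)
      have h4 : Y x y = (C (y⁻¹ * x) y⁻¹)⁻¹ := by
        rw [hC, inv_inv, inv_inv, mul_inv_cancel_left₀ hy]
      have h2 : C (y⁻¹ * x) y⁻¹ ≠ 0 := fun h => (H2 x y hx hy).2 (by rw [h4, h, _root_.inv_zero])
      have h3 : C (y⁻¹ * x) y⁻¹ =
          q * (τ y)⁻¹ * (1 + τ x * (p⁻¹ * l) + τ y * (q⁻¹ * l')) := by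
        rw [h1, heτ _ hd, mul_add, mul_add, mul_one, mul_assoc q _ (τ y * _),
          inv_mul_cancel_left₀ (hτ y hy), mul_inv_cancel_left₀ hq, map_mul, map_inv₀]
        simp only [mul_assoc]
        abel
      have h5 : Y x y = (1 + τ x * (p⁻¹ * l) + τ y * (q⁻¹ * l'))⁻¹ * (τ y * q⁻¹) := by
        rw [h4, h3, _root_.mul_inv_rev, _root_.mul_inv_rev, inv_inv]
      refine ⟨fun h => h2 (by rw [h3, h, mul_zero]), ?_, h5⟩
      rw [H3 x y hx hy, h5, heτ _ hd, map_mul, map_inv₀]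
      simp only [mul_assoc]
      rw [inv_mul_cancel_left₀ hq, mul_inv_cancel_left₀ (hτ y hy)]

/-- The coordinate formula of `exists_ringHom_of_plane_coordinates` on an axis determines its
parameters. -/
theorem ringHom_eq_of_axis_eq
    (hD : ∀ a b c : D, ∃ d, d ≠ a ∧ d ≠ b ∧ d ≠ c) {τ τ' : D →+* D'} {u u' w w' : D'}
    (hu : u ≠ 0)
    (h : ∀ x, (1 + τ x * w)⁻¹ * (τ x * u) = (1 + τ' x * w')⁻¹ * (τ' x * u')) :
    τ = τ' ∧ u = u' ∧ w = w' := by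
  have hτ : ∀ (σ : D →+* D') (s : D), s ≠ 0 → σ s ≠ 0 := fun σ s hs => (map_ne_zero σ).2 hs
  have h3 : ∀ (σ : D →+* D') (z v : D') (s : D), s ≠ 0 →
      v⁻¹ * (σ s + z) = ((1 + σ s⁻¹ * z)⁻¹ * (σ s⁻¹ * v))⁻¹ := by
    intro σ z v s hs
    rw [_root_.mul_inv_rev, _root_.mul_inv_rev, inv_inv, map_inv₀, inv_inv, mul_assoc,
      mul_add (σ s), mul_one, mul_inv_cancel_left₀ (hτ σ s hs)]
  have h4 : ∀ s, s ≠ 0 → u⁻¹ * (τ s + w) = u'⁻¹ * (τ' s + w') := by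
    intro s hs
    rw [h3 τ w u s hs, h3 τ' w' u' s hs, h]
  have h5 : ∀ k, u⁻¹ * τ k = u'⁻¹ * τ' k := by
    intro k
    obtain ⟨s, hs0, hsk, -⟩ := hD 0 (-k) 0
    have h6 := h4 (s + k) fun h => hsk (eq_neg_of_add_eq_zero_left h)
    have h7 := h4 s hs0
    simp only [map_add, mul_add] at h6 h7
    linear_combination (norm := abel) h6 - h7
  have h6 : u = u' := by simpa using h5 1
  subst h6
  have h7 : τ = τ' := RingHom.ext fun k => mul_left_cancel₀ (inv_ne_zero hu) (h5 k)
  subst h7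
  exact ⟨rfl, rfl, add_left_cancel (mul_left_cancel₀ (inv_ne_zero hu) (h4 1 one_ne_zero))⟩

/-- A map between left vector spaces that maps the line through `y` and `z` into the line through
the images of `y` and `z`. -/
def IsLineation (K K' : Type*) [DivisionRing K] [DivisionRing K'] {V W : Type*} [AddCommGroup V]
    [Module K V] [AddCommGroup W] [Module K' W] (f : V → W) : Prop :=
  ∀ y z, ∀ r : K, ∃ ρ : K', f (y + r • (z - y)) = f y + ρ • (f z - f y)

variable {V V' W : Type*} [AddCommGroup V] [Module D V] [AddCommGroup V'] [Module D V']
  [AddCommGroup W] [Module D' W]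

theorem IsLineation.comp_linearMap {f : V → W} (hf : IsLineation D D' f) (g : V' →ₗ[D] V) :
    IsLineation D D' (f ∘ g) := by
  intro y z r
  obtain ⟨ρ, hρ⟩ := hf (g y) (g z) r
  exact ⟨ρ, by simpa using hρ⟩

/-- A lineation of the plane preserving two axes is projective. -/
theorem IsLineation.exists_ringHom_of_plane
    (hD : ∀ a b c : D, ∃ d, d ≠ a ∧ d ≠ b ∧ d ≠ c) {F : D × D → W} (hF : IsLineation D D' F)
    (hinj : Function.Injective F) {v₁ v₂ : W}
    (hv : ∀ a b : D', a • v₁ + b • v₂ = 0 → a = 0 ∧ b = 0)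
    (h1 : ∀ x, ∃ a : D', F (x, 0) = a • v₁) (h2 : ∀ y, ∃ b : D', F (0, y) = b • v₂) :
    ∃ (τ : D →+* D') (u v w w' : D'), u ≠ 0 ∧ v ≠ 0 ∧ ∀ x y, 1 + τ x * w + τ y * w' ≠ 0 ∧
      F (x, y) = (1 + τ x * w + τ y * w')⁻¹ • ((τ x * u) • v₁ + (τ y * v) • v₂) := by
  have hspan : ∀ x y, ∃ a b : D', F (x, y) = a • v₁ + b • v₂ := by
    intro x y
    obtain ⟨r, hr0, hr1, -⟩ := hD 0 1 0
    obtain ⟨ρ, hρ⟩ := hF ((1 - r)⁻¹ * x, 0) (0, r⁻¹ * y) r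
    obtain ⟨a, ha⟩ := h1 ((1 - r)⁻¹ * x)
    obtain ⟨b, hb⟩ := h2 (r⁻¹ * y)
    refine ⟨a - ρ * a, ρ * b, ?_⟩
    have e1 : (((1 - r)⁻¹ * x, 0) + r • ((0, r⁻¹ * y) - ((1 - r)⁻¹ * x, 0)) : D × D) = (x, y) := by
      ext
      · simp only [Prod.fst_add, Prod.smul_fst, Prod.fst_sub, zero_sub, smul_eq_mul, mul_neg]
        rw [← sub_eq_add_neg]
        nth_rewrite 1 [← one_mul ((1 - r)⁻¹ * x)]
        rw [← sub_mul, mul_inv_cancel_left₀ (sub_ne_zero.2 hr1.symm)]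
      · simp [mul_inv_cancel_left₀ hr0]
    rw [e1, ha, hb] at hρ
    rw [hρ, sub_smul, smul_sub, mul_smul, mul_smul]
    abel
  have huniq : ∀ a b a' b' : D', a • v₁ + b • v₂ = a' • v₁ + b' • v₂ → a = a' ∧ b = b' := by
    intro a b a' b' h
    have := hv (a - a') (b - b') (by
      rw [sub_smul, sub_smul]
      rw [← sub_eq_zero] at h
      rw [← h]
      abel)
    exact ⟨sub_eq_zero.1 this.1, sub_eq_zero.1 this.2⟩
  choose X Y hXY using hspan
  obtain ⟨τ, u, v, w, w', hu, hv, H⟩ := exists_ringHom_of_plane_coordinates hD X Y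
    (by
      intro x y x' y' hX hY
      have : (x, y) = (x', y') := hinj (by rw [hXY, hXY, hX, hY])
      exact ⟨congrArg Prod.fst this, congrArg Prod.snd this⟩)
    (by
      intro x y x' y' r
      obtain ⟨ρ, hρ⟩ := hF (x, y) (x', y') r
      refine ⟨ρ, huniq _ _ _ _ ?_⟩
      have e1 : ((x, y) + r • ((x', y') - (x, y)) : D × D) =
        (x + r * (x' - x), y + r * (y' - y)) := rfl
      rw [e1, hXY, hXY, hXY] at hρ
      rw [hρ, add_smul, add_smul, mul_smul, mul_smul, sub_smul, sub_smul, smul_sub, smul_sub,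
        smul_sub, smul_add, smul_add]
      abel)
    (by
      intro y
      obtain ⟨b, hb⟩ := h2 y
      refine (huniq _ (Y 0 y) 0 b ?_).1
      rw [← hXY, hb, zero_smul, zero_add])
    (by
      intro x
      obtain ⟨b, hb⟩ := h1 x
      refine (huniq (X x 0) _ b 0 ?_).2
      rw [← hXY, hb, zero_smul, add_zero])
  refine ⟨τ, u, v, w, w', hu, hv, fun x y => ⟨(H x y).1, ?_⟩⟩
  rw [hXY, (H x y).2.1, (H x y).2.2, smul_add, ← mul_smul, ← mul_smul]

theorem IsLineation.exists_ringHom_of_pair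
    (hD : ∀ a b c : D, ∃ d, d ≠ a ∧ d ≠ b ∧ d ≠ c) {f : V → W} (hf : IsLineation D D' f)
    (hinj : Function.Injective f) {a b : V} {v₁ v₂ : W}
    (hab : ∀ s t : D, s • a + t • b = 0 → s = 0 ∧ t = 0)
    (hv : ∀ s t : D', s • v₁ + t • v₂ = 0 → s = 0 ∧ t = 0)
    (h1 : ∀ x : D, ∃ c : D', f (x • a) = c • v₁) (h2 : ∀ y : D, ∃ c : D', f (y • b) = c • v₂) :
    ∃ (τ : D →+* D') (u v w w' : D'), u ≠ 0 ∧ v ≠ 0 ∧ ∀ x y, 1 + τ x * w + τ y * w' ≠ 0 ∧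
      f (x • a + y • b) =
        (1 + τ x * w + τ y * w')⁻¹ • ((τ x * u) • v₁ + (τ y * v) • v₂) := by
  let g : D × D →ₗ[D] V :=
    LinearMap.coprod (LinearMap.toSpanSingleton D V a) (LinearMap.toSpanSingleton D V b)
  have hg : ∀ x y, g (x, y) = x • a + y • b := fun x y => by simp [g]
  have hginj : Function.Injective g := by
    rw [injective_iff_map_eq_zero]
    rintro ⟨x, y⟩ h
    rw [hg] at h
    exact Prod.ext (hab x y h).1 (hab x y h).2
  obtain ⟨τ, u, v, w, w', hu, hv, H⟩ := (hf.comp_linearMap g).exists_ringHom_of_plane hD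
    (hinj.comp hginj) hv (fun x => by simpa [hg] using h1 x) (fun y => by simpa [hg] using h2 y)
  exact ⟨τ, u, v, w, w', hu, hv, fun x y => ⟨(H x y).1, by rw [← hg]; exact (H x y).2⟩⟩

theorem Fintype.sum_eq_add_sum_update_zero {ι M : Type*} [Fintype ι] [DecidableEq ι]
    [AddCommMonoid M] {g : D → ι → M} (hg : ∀ j, g 0 j = 0) (x : ι → D) (a : ι) :
    ∑ j, g (x j) j = g (x a) a + ∑ j, g (Function.update x a 0 j) j := by
  rw [Fintype.sum_eq_add_sum_compl a,
    Fintype.sum_eq_add_sum_compl a (fun j => g (Function.update x a 0 j) j),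
    Function.update_self, hg, zero_add]
  congr 1
  refine Finset.sum_congr rfl fun j hj => ?_
  have : j ≠ a := by simpa using hj
  simp [this]

/-- The fundamental theorem of projective geometry for lineations of an affine space of dimension
at least two preserving the axes. -/
theorem IsLineation.exists_ringHom
    (hD : ∀ a b c : D, ∃ d, d ≠ a ∧ d ≠ b ∧ d ≠ c) {ι : Type*} [Fintype ι] [DecidableEq ι]
    [Nontrivial ι] {f : (ι → D) → W} (hf : IsLineation D D' f) (hinj : Function.Injective f)
    (hf0 : f 0 = 0) {e : ι → W} (he : LinearIndependent D' e)
    (hax : ∀ j x, ∃ a : D', f (Pi.single j x) = a • e j) :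
    ∃ (τ : D →+* D') (q w : ι → D'), (∀ j, q j ≠ 0) ∧ ∀ x, 1 + ∑ j, τ (x j) * w j ≠ 0 ∧
      f x = (1 + ∑ j, τ (x j) * w j)⁻¹ • ∑ j, (τ (x j) * q j) • e j := by
  have he0 : ∀ j, e j ≠ 0 := fun j => he.ne_zero j
  have hs1 : ∀ (j : ι) (x : D), x • (Pi.single j 1 : ι → D) = Pi.single j x := fun j x => by
    rw [← Pi.single_smul, smul_eq_mul, mul_one]
  have hax' : ∀ j (x : D), ∃ a : D', f (x • (Pi.single j 1 : ι → D)) = a • e j := fun j x => by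
    rw [hs1]
    exact hax j x
  have hpair : ∀ i j, i ≠ j → LinearIndependent D' ![e i, e j] := fun i j hij => by
    have h := he.comp ![i, j] (by
      intro k l hkl
      fin_cases k <;> fin_cases l <;> simp [hij, hij.symm] at hkl ⊢)
    convert h using 1
    ext k
    fin_cases k <;> rfl
  have hplane : ∀ i j, i ≠ j → ∃ (τ : D →+* D') (u v w w' : D'), u ≠ 0 ∧ v ≠ 0 ∧
      (∀ x, 1 + τ x * w ≠ 0 ∧ f (Pi.single i x) = ((1 + τ x * w)⁻¹ * (τ x * u)) • e i) ∧
      (∀ x, 1 + τ x * w' ≠ 0 ∧ f (Pi.single j x) = ((1 + τ x * w')⁻¹ * (τ x * v)) • e j) := by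
    intro i j hij
    obtain ⟨τ, u, v, w, w', hu, hv, H⟩ := hf.exists_ringHom_of_pair hD hinj
      (a := Pi.single i 1) (b := Pi.single j 1)
      (by
        intro s t h
        rw [hs1, hs1] at h
        exact ⟨by simpa [hij] using congrFun h i, by simpa [hij.symm] using congrFun h j⟩)
      (LinearIndependent.pair_iff.1 (hpair i j hij)) (hax' i) (hax' j)
    refine ⟨τ, u, v, w, w', hu, hv, fun x => ?_, fun x => ?_⟩
    · simpa [hs1, mul_smul] using H x 0
    · simpa [hs1, mul_smul] using H 0 x
  have hcancel : ∀ {v : W}, v ≠ 0 → ∀ {τ τ' : D →+* D'} {u u' w w' : D'}, u ≠ 0 →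
      (∀ x, ((1 + τ x * w)⁻¹ * (τ x * u)) • v = ((1 + τ' x * w')⁻¹ * (τ' x * u')) • v) →
      τ = τ' ∧ u = u' ∧ w = w' := fun hv _ _ _ _ _ _ hu h =>
    ringHom_eq_of_axis_eq hD hu fun x => smul_left_injective D' hv (h x)
  obtain ⟨j₀, j₁, hj⟩ := exists_pair_ne ι
  obtain ⟨τ, u₀, -, w₀, -, hu₀, -, H₀, -⟩ := hplane j₀ j₁ hj
  have haxis : ∀ j, ∃ q w : D', q ≠ 0 ∧ ∀ x, 1 + τ x * w ≠ 0 ∧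
      f (Pi.single j x) = ((1 + τ x * w)⁻¹ * (τ x * q)) • e j := by
    intro j
    by_cases h : j₀ = j
    · subst h
      exact ⟨u₀, w₀, hu₀, H₀⟩
    · obtain ⟨σ, u, v, w, w', hu, hv, h1, h2⟩ := hplane j₀ j h
      obtain ⟨rfl, -, -⟩ := hcancel (he0 j₀) hu₀
        fun x => (H₀ x).2.symm.trans (h1 x).2
      exact ⟨v, w', hv, h2⟩
  choose q w hq H using haxis
  refine ⟨τ, q, w, hq, ?_⟩
  suffices key : ∀ S : Finset ι, ∀ x : ι → D, (∀ j, j ∉ S → x j = 0) →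
      1 + ∑ j, τ (x j) * w j ≠ 0 ∧
      f x = (1 + ∑ j, τ (x j) * w j)⁻¹ • ∑ j, (τ (x j) * q j) • e j from
    fun x => key Finset.univ x fun j hj => absurd (Finset.mem_univ j) hj
  intro S
  induction S using Finset.induction_on with
  | empty =>
    intro x hx
    obtain rfl : x = 0 := funext fun j => hx j (Finset.notMem_empty j)
    simp [hf0]
  | insert a S ha ih =>
    intro x hx
    set y : ι → D := Function.update x a 0 with hy
    have hya : y a = 0 := by simp [hy]
    have hyS : ∀ (t : D) j, j ∉ S → (t • y) j = 0 := by
      intro t j hj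
      by_cases h : j = a
      · subst h
        simp [hya]
      · simp [hy, h, hx j (by simp [h, hj])]
    have hxy : x = x a • Pi.single a 1 + (1 : D) • y := by
      rw [hs1, one_smul]
      ext j
      by_cases h : j = a
      · subst h
        simp [hya]
      · simp [hy, h]
    by_cases hy0 : y = 0
    · have h1 := Fintype.sum_eq_add_sum_update_zero (g := fun t j => τ t * w j) (by simp) x a
      have h2 := Fintype.sum_eq_add_sum_update_zero (g := fun t j => (τ t * q j) • e j) (by simp)
        x a
      have h3 : x = Pi.single a (x a) := by
        rw [hs1, hy0, smul_zero, add_zero] at hxy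
        exact hxy
      simp only [← hy, hy0, Pi.zero_apply, map_zero, zero_mul, zero_smul, Finset.sum_const_zero,
        add_zero] at h1 h2
      rw [h1, h2, ← mul_smul]
      refine ⟨(H a (x a)).1, ?_⟩
      rw [← (H a (x a)).2, ← h3]
    · set yy : W := ∑ j, (τ (y j) * q j) • e j with hyy
      have ihy : ∀ t : D, f (t • y) =
          ((1 + τ t * ∑ j, τ (y j) * w j)⁻¹ * (τ t * 1)) • yy := by
        intro t
        rw [(ih (t • y) (hyS t)).2]
        simp only [Pi.smul_apply, smul_eq_mul, map_mul, mul_assoc, mul_smul, ← Finset.mul_sum,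
          mul_one, hyy, Finset.smul_sum]
      have hyy' : ∀ s t : D', s • e a + t • yy = 0 → s = 0 ∧ t = 0 := by
        intro s t h
        have h1 : ∑ j, ((Pi.single a s : ι → D') + fun j => t * (τ (y j) * q j)) j • e j = 0 := by
          rw [← h, hyy, Finset.smul_sum]
          simp only [Pi.add_apply, add_smul, Finset.sum_add_distrib, mul_smul]
          congr 1
          rw [Finset.sum_eq_single a] <;> simp +contextual
        have h2 := Fintype.linearIndependent_iff.1 he _ h1
        constructor
        · simpa [hya] using h2 a
        · obtain ⟨j, hj⟩ := Function.ne_iff.1 hy0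
          have hja : j ≠ a := fun h => hj (by rw [h, hya]; rfl)
          have h3 := h2 j
          simp only [Pi.add_apply, Pi.single_eq_of_ne hja, zero_add] at h3
          exact (mul_eq_zero.1 h3).resolve_right
            (mul_ne_zero ((map_ne_zero τ).2 hj) (hq j))
      have hyy0 : yy ≠ 0 := fun h => one_ne_zero (hyy' 0 1 (by rw [h]; simp)).2
      obtain ⟨σ, u, v, z, z', hu, hv, K⟩ := hf.exists_ringHom_of_pair hD hinj
        (a := Pi.single a 1) (b := y) (v₁ := e a) (v₂ := yy)
        (by
          intro s t h
          rw [hs1] at h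
          obtain ⟨j, hj⟩ := Function.ne_iff.1 hy0
          have hja : j ≠ a := fun h => hj (by rw [h, hya]; rfl)
          have h1 := congrFun h a
          have h2 := congrFun h j
          simp only [Pi.add_apply, Pi.single_eq_same, Pi.smul_apply, hya, smul_eq_mul, mul_zero,
            add_zero, Pi.zero_apply] at h1
          simp only [Pi.add_apply, Pi.single_eq_of_ne hja, Pi.smul_apply, smul_eq_mul,
            zero_add, Pi.zero_apply] at h2
          exact ⟨h1, (mul_eq_zero.1 h2).resolve_right hj⟩)
        hyy' (hax' a) (fun t => ⟨_, ihy t⟩)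
      obtain ⟨rfl, rfl, rfl⟩ := hcancel (he0 a) (hq a) (τ' := σ) (u' := u) (w' := z) fun s => by
        rw [← (H a s).2]
        simpa [hs1, mul_smul] using (K s 0).2
      obtain ⟨-, rfl, rfl⟩ := hcancel hyy0 one_ne_zero (τ' := τ) (u' := v) (w' := z') fun t => by
        rw [← ihy t]
        simpa [mul_smul] using (K 0 t).2
      have h1 := Fintype.sum_eq_add_sum_update_zero (g := fun t j => τ t * w j) (by simp) x a
      have h2 := Fintype.sum_eq_add_sum_update_zero (g := fun t j => (τ t * q j) • e j) (by simp)
        x a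
      simp only [← hy] at h1 h2
      have h3 := K (x a) 1
      rw [← hxy, map_one, one_mul, one_mul, one_smul, add_assoc, ← h1, ← h2] at h3
      exact h3

end Lineation

section RankOne

variable {R : Type*} [DivisionRing R] {ι κ : Type*}

/-- The matrices all of whose columns are right multiples of `u`. -/
def rowLine (κ : Type*) (u : ι → R) : Set (Matrix ι κ R) :=
  {A | ∃ r, A = vecMulVec u r}

/-- The matrices all of whose rows are left multiples of `x`. -/
def colLine (ι : Type*) (x : κ → R) : Set (Matrix ι κ R) :=
  {A | ∃ c, A = vecMulVec c x}

theorem vecMulVec_zero_right (u : ι → R) : vecMulVec u (0 : κ → R) = 0 :=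
  ext fun _ _ => mul_zero _

theorem vecMulVec_mul_right_eq (u : ι → R) (k : R) (x : κ → R) :
    vecMulVec (fun i => u i * k) x = vecMulVec u (k • x) := by
  ext i j
  simp [vecMulVec_apply, mul_assoc]

theorem vecMulVec_ne_zero_of_ne {u : ι → R} {x : κ → R} (hu : u ≠ 0) (hx : x ≠ 0) :
    vecMulVec u x ≠ 0 := by
  obtain ⟨i, hi⟩ := Function.ne_iff.1 hu
  obtain ⟨j, hj⟩ := Function.ne_iff.1 hx
  exact fun h => mul_ne_zero hi hj (congrFun (congrFun h i) j)

theorem zero_mem_rowLine (u : ι → R) : (0 : Matrix ι κ R) ∈ rowLine κ u :=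
  ⟨0, (vecMulVec_zero_right u).symm⟩

theorem zero_mem_colLine (x : κ → R) : (0 : Matrix ι κ R) ∈ colLine ι x := ⟨0, by simp⟩

theorem exists_eq_mul_right_of_mem_rowLine {u u' : ι → R} {A : Matrix ι κ R} (hA : A ≠ 0)
    (h : A ∈ rowLine κ u) (h' : A ∈ rowLine κ u') : ∃ k ≠ 0, ∀ i, u i = u' i * k := by
  obtain ⟨r, rfl⟩ := h
  obtain ⟨r', h'⟩ := h'
  symm at h'
  have hr : r ≠ 0 := by rintro rfl; simp [vecMulVec_zero_right] at hA
  have hu : u ≠ 0 := by rintro rfl; simp at hA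
  obtain ⟨j, hj⟩ := Function.ne_iff.1 hr
  have key : ∀ i, u i = u' i * (r' j * (r j)⁻¹) := fun i => by
    have := congrFun (congrFun h' i) j
    simp only [vecMulVec_apply] at this
    rw [← mul_assoc, this, mul_inv_cancel_right₀ hj]
  refine ⟨_, fun h0 => hu (funext fun i => ?_), key⟩
  rw [key, h0, mul_zero, Pi.zero_apply]

theorem exists_eq_mul_left_of_mem_colLine {x x' : κ → R} {A : Matrix ι κ R} (hA : A ≠ 0)
    (h : A ∈ colLine ι x) (h' : A ∈ colLine ι x') : ∃ k : R, k ≠ 0 ∧ x = k • x' := by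
  obtain ⟨c, rfl⟩ := h
  obtain ⟨c', h'⟩ := h'
  symm at h'
  have hc : c ≠ 0 := by rintro rfl; simp at hA
  have hx : x ≠ 0 := by rintro rfl; simp [vecMulVec_zero_right] at hA
  obtain ⟨i, hi⟩ := Function.ne_iff.1 hc
  have key : x = ((c i)⁻¹ * c' i) • x' := funext fun j => by
    have := congrFun (congrFun h' i) j
    simp only [vecMulVec_apply] at this
    rw [Pi.smul_apply, smul_eq_mul, mul_assoc, this, inv_mul_cancel_left₀ hi]
  exact ⟨_, fun h0 => hx (by rw [key, h0, zero_smul]), key⟩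

theorem rowLine_eq_of_mul_right {u u' : ι → R} {k : R} (hk : k ≠ 0) (h : ∀ i, u i = u' i * k) :
    rowLine κ u = rowLine κ u' := by
  have h1 : u = fun i => u' i * k := funext h
  ext A
  constructor
  · rintro ⟨r, rfl⟩
    exact ⟨k • r, by rw [h1, vecMulVec_mul_right_eq]⟩
  · rintro ⟨r, rfl⟩
    exact ⟨k⁻¹ • r, by rw [h1, vecMulVec_mul_right_eq, smul_smul, mul_inv_cancel₀ hk, one_smul]⟩

theorem colLine_eq_of_mul_left {x x' : κ → R} {k : R} (hk : k ≠ 0) (h : x = k • x') :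
    colLine ι x = colLine ι x' := by
  ext A
  constructor
  · rintro ⟨c, rfl⟩
    exact ⟨fun i => c i * k, by rw [h, vecMulVec_mul_right_eq]⟩
  · rintro ⟨c, rfl⟩
    exact ⟨fun i => c i * k⁻¹, by
      simp only [h]
      rw [vecMulVec_mul_right_eq, smul_smul, inv_mul_cancel₀ hk, one_smul]⟩

theorem rowLine_eq_of_mem {u u' : ι → R} {A : Matrix ι κ R} (hA : A ≠ 0)
    (h : A ∈ rowLine κ u) (h' : A ∈ rowLine κ u') : rowLine κ u = rowLine κ u' := by
  obtain ⟨k, hk, H⟩ := exists_eq_mul_right_of_mem_rowLine hA h h'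
  exact rowLine_eq_of_mul_right hk H

theorem colLine_eq_of_mem {x x' : κ → R} {A : Matrix ι κ R} (hA : A ≠ 0)
    (h : A ∈ colLine ι x) (h' : A ∈ colLine ι x') : colLine ι x = colLine ι x' := by
  obtain ⟨k, hk, H⟩ := exists_eq_mul_left_of_mem_colLine hA h h'
  exact colLine_eq_of_mul_left hk H

/-- If two matrices of rank at most one differ by a matrix of rank at most one, then they share
their row space or their column space. -/
theorem mem_rowLine_or_mem_colLine {a e c : ι → R} {b f d : κ → R}
    (h : vecMulVec a b - vecMulVec c d = vecMulVec e f) (hc : c ≠ 0) (hd : d ≠ 0) :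
    vecMulVec a b ∈ rowLine κ c ∨ vecMulVec a b ∈ colLine ι d := by
  obtain ⟨j₀, hj₀⟩ := Function.ne_iff.1 hd
  rw [Pi.zero_apply] at hj₀
  by_cases hb : b = (b j₀ * (d j₀)⁻¹) • d
  · right
    rw [hb, ← vecMulVec_mul_right_eq]
    exact ⟨_, rfl⟩
  left
  by_cases ha : a = 0
  · rw [ha, zero_vecMulVec]
    exact zero_mem_rowLine c
  obtain ⟨j₁, hj₁⟩ := Function.ne_iff.1 hb
  rw [Pi.smul_apply, smul_eq_mul, ← sub_ne_zero] at hj₁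
  set β := b j₁ - b j₀ * (d j₀)⁻¹ * d j₁ with hβ
  set φ := f j₁ - f j₀ * (d j₀)⁻¹ * d j₁ with hφ
  have hent : ∀ i j, a i * b j - c i * d j = e i * f j := fun i j => congrFun (congrFun h i) j
  have h1 : ∀ i, a i * β = e i * φ := by
    intro i
    rw [hβ, hφ, mul_sub, mul_sub, ← hent i j₁, ← mul_assoc, ← mul_assoc, ← mul_assoc, ← mul_assoc,
      ← hent i j₀, sub_mul, sub_mul, mul_inv_cancel_right₀ hj₀]
    abel
  obtain ⟨i₀, hi₀⟩ := Function.ne_iff.1 ha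
  have hφ0 : φ ≠ 0 := fun h0 => mul_ne_zero hi₀ hj₁ (by rw [h1, h0, mul_zero])
  have h2 : ∀ i, c i * d j₀ = a i * (b j₀ - β * φ⁻¹ * f j₀) := by
    intro i
    have : e i = a i * β * φ⁻¹ := by rw [h1, mul_inv_cancel_right₀ hφ0]
    have h3 := hent i j₀
    rw [this] at h3
    rw [mul_sub, ← mul_assoc, ← mul_assoc, ← h3]
    abel
  set s := b j₀ - β * φ⁻¹ * f j₀ with hs
  have hs0 : s ≠ 0 := by
    intro h0
    obtain ⟨i, hi⟩ := Function.ne_iff.1 hc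
    exact mul_ne_zero hi hj₀ (by rw [h2, h0, mul_zero])
  have h3 : a = fun i => c i * (d j₀ * s⁻¹) := funext fun i => by
    rw [← mul_assoc, h2, mul_inv_cancel_right₀ hs0]
  rw [h3, vecMulVec_mul_right_eq]
  exact ⟨_, rfl⟩

/-- A set of matrices whose pairwise differences have rank at most one is contained in a maximal
set. -/
theorem subset_rowLine_or_subset_colLine [Nonempty ι] {S : Set (Matrix ι κ R)}
    (h0 : (0 : Matrix ι κ R) ∈ S) (hS : ∀ A ∈ S, ∀ B ∈ S, ∃ e f, A - B = vecMulVec e f) :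
    (∃ u, u ≠ 0 ∧ S ⊆ rowLine κ u) ∨ ∃ x, x ≠ 0 ∧ S ⊆ colLine ι x := by
  by_cases hC : ∀ C ∈ S, C = 0
  · exact Or.inl ⟨1, one_ne_zero, fun C hCS => by rw [hC C hCS]; exact zero_mem_rowLine _⟩
  push Not at hC
  obtain ⟨C, hCS, hC0⟩ := hC
  obtain ⟨c, d, hcd⟩ := hS C hCS 0 h0
  rw [sub_zero] at hcd
  have hc : c ≠ 0 := by rintro rfl; simp [hcd] at hC0
  have hd : d ≠ 0 := by rintro rfl; simp [hcd, vecMulVec_zero_right] at hC0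
  have key : ∀ A ∈ S, A ∈ rowLine κ c ∨ A ∈ colLine ι d := by
    intro A hA
    obtain ⟨a, b, hab⟩ := hS A hA 0 h0
    obtain ⟨e, f, hef⟩ := hS A hA C hCS
    rw [sub_zero] at hab
    rw [hab, hcd] at hef
    rw [hab]
    exact mem_rowLine_or_mem_colLine hef hc hd
  by_cases h1 : S ⊆ rowLine κ c
  · exact Or.inl ⟨c, hc, h1⟩
  by_cases h2 : S ⊆ colLine ι d
  · exact Or.inr ⟨d, hd, h2⟩
  exfalso
  obtain ⟨A, hA, hA'⟩ := Set.not_subset.1 h1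
  obtain ⟨B, hB, hB'⟩ := Set.not_subset.1 h2
  obtain ⟨a, rfl⟩ := (key A hA).resolve_left hA'
  obtain ⟨b, rfl⟩ := (key B hB).resolve_right hB'
  have hb : b ≠ 0 := by
    rintro rfl
    rw [vecMulVec_zero_right] at hB'
    exact hB' (zero_mem_colLine d)
  obtain ⟨e, f, hef⟩ := hS _ hA _ hB
  rcases mem_rowLine_or_mem_colLine hef hc hb with h3 | h3
  · exact hA' h3
  · refine hB' ?_
    have ha : vecMulVec a d ≠ 0 := fun h => hA' (by rw [h]; exact zero_mem_rowLine c)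
    rw [colLine_eq_of_mem ha ⟨a, rfl⟩ h3]
    exact ⟨c, rfl⟩

end RankOne

/-- In a grid whose lines lie in sets of two families, either no line in the first direction lies
in a set of the first family, or all lines in the second direction lie in sets of the second
family, unless the grid is covered by two sets of different families. -/
theorem exists_mem_of_grid {U V G : Type*} [Zero G] {M N : Set (Set G)}
    (hM : ∀ s ∈ M, ∀ s' ∈ M, ∀ a, a ≠ 0 → a ∈ s → a ∈ s' → s = s')
    (hN : ∀ s ∈ N, ∀ s' ∈ N, ∀ a, a ≠ 0 → a ∈ s → a ∈ s' → s = s')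
    (g : U → V → G) (hg : ∀ u x, g u x ≠ 0)
    (hU : ∀ u, (∃ s ∈ M, ∀ x, g u x ∈ s) ∨ ∃ t ∈ N, ∀ x, g u x ∈ t)
    (hV : ∀ x, (∃ s ∈ M, ∀ u, g u x ∈ s) ∨ ∃ t ∈ N, ∀ u, g u x ∈ t)
    (hnd : ∀ s ∈ M, ∀ t ∈ N, ∃ u x, g u x ∉ s ∧ g u x ∉ t) (hne : N.Nonempty)
    {u₀ : U} (h₀ : ∃ s ∈ M, ∀ x, g u₀ x ∈ s) (x : V) : ∃ t ∈ N, ∀ u, g u x ∈ t := by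
  refine (hV x).resolve_left ?_
  rintro ⟨s, hs, hsx⟩
  obtain ⟨s₀, hs₀, hsx₀⟩ := h₀
  obtain rfl := hM s hs s₀ hs₀ _ (hg u₀ x) (hsx u₀) (hsx₀ x)
  obtain ⟨t₁, ht₁⟩ := hne
  obtain ⟨u₂, x₂, h2, -⟩ := hnd s hs t₁ ht₁
  obtain ⟨t, ht, htx⟩ : ∃ t ∈ N, ∀ x, g u₂ x ∈ t := by
    refine (hU u₂).resolve_left ?_
    rintro ⟨s₂, hs₂, h3⟩
    obtain rfl := hM s hs s₂ hs₂ _ (hg u₂ x) (hsx u₂) (h3 x)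
    exact h2 (h3 x₂)
  obtain ⟨u₃, x₃, h3, h4⟩ := hnd s hs t ht
  rcases hV x₃ with ⟨s₃, hs₃, h5⟩ | ⟨t₃, ht₃, h5⟩
  · obtain rfl := hM s hs s₃ hs₃ _ (hg u₀ x₃) (hsx₀ x₃) (h5 u₀)
    exact h3 (h5 u₃)
  · obtain rfl := hN t ht t₃ ht₃ _ (hg u₂ x₃) (htx x₃) (h5 u₂)
    exact h4 (h5 u₃)

section Local

variable {D D' : Type*} [DivisionRing D] [DivisionRing D'] {ι κ ι' κ' : Type*}

/-- A map between spaces of matrices that maps adjacent matrices to adjacent ones, and all of whose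
restrictions to unit balls around matrices of rank at most one preserve the two types of maximal
sets. -/
structure IsLocallyStandard (θ : Matrix ι κ D → Matrix ι' κ' D') : Prop where
  adj : ∀ A u x, u ≠ 0 → x ≠ 0 →
    ∃ u' x', u' ≠ 0 ∧ x' ≠ 0 ∧ θ (A + vecMulVec u x) = θ A + vecMulVec u' x'
  row : ∀ a b u, u ≠ 0 → ∃ u', u' ≠ 0 ∧
    ∀ x, θ (vecMulVec a b + vecMulVec u x) - θ (vecMulVec a b) ∈ rowLine κ' u'
  col : ∀ a b x, x ≠ 0 → ∃ x', x' ≠ 0 ∧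
    ∀ u, θ (vecMulVec a b + vecMulVec u x) - θ (vecMulVec a b) ∈ colLine ι' x'

variable {θ : Matrix ι κ D → Matrix ι' κ' D'}

section Dichotomy

variable [Nonempty ι']

theorem row_dichotomy_of_adj (hadj : ∀ A u x, u ≠ 0 → x ≠ 0 →
    ∃ u' x', u' ≠ 0 ∧ x' ≠ 0 ∧ θ (A + vecMulVec u x) = θ A + vecMulVec u' x')
    (A : Matrix ι κ D) {u : ι → D} (hu : u ≠ 0) :
    (∃ u', u' ≠ 0 ∧ ∀ x, θ (A + vecMulVec u x) - θ A ∈ rowLine κ' u') ∨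
      ∃ x', x' ≠ 0 ∧ ∀ x, θ (A + vecMulVec u x) - θ A ∈ colLine ι' x' := by
  have := subset_rowLine_or_subset_colLine
    (S := Set.range fun x => θ (A + vecMulVec u x) - θ A)
    ⟨0, by simp [vecMulVec_zero_right]⟩ (by
      rintro _ ⟨x, rfl⟩ _ ⟨y, rfl⟩
      by_cases hxy : x = y
      · exact ⟨0, 0, by simp [hxy, vecMulVec_zero_right]⟩
      obtain ⟨e, f, -, -, h⟩ := hadj (A + vecMulVec u y) u (x - y) hu (sub_ne_zero.2 hxy)
      refine ⟨e, f, ?_⟩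
      rw [add_assoc, ← vecMulVec_add, add_sub_cancel] at h
      simp only [h]
      abel)
  simpa only [Set.range_subset_iff] using this

theorem col_dichotomy_of_adj (hadj : ∀ A u x, u ≠ 0 → x ≠ 0 →
    ∃ u' x', u' ≠ 0 ∧ x' ≠ 0 ∧ θ (A + vecMulVec u x) = θ A + vecMulVec u' x')
    (A : Matrix ι κ D) {x : κ → D} (hx : x ≠ 0) :
    (∃ u', u' ≠ 0 ∧ ∀ u, θ (A + vecMulVec u x) - θ A ∈ rowLine κ' u') ∨
      ∃ x', x' ≠ 0 ∧ ∀ u, θ (A + vecMulVec u x) - θ A ∈ colLine ι' x' := by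
  have := subset_rowLine_or_subset_colLine
    (S := Set.range fun u => θ (A + vecMulVec u x) - θ A)
    ⟨0, by simp⟩ (by
      rintro _ ⟨u, rfl⟩ _ ⟨v, rfl⟩
      by_cases huv : u = v
      · exact ⟨0, 0, by simp [huv, vecMulVec_zero_right]⟩
      obtain ⟨e, f, -, -, h⟩ := hadj (A + vecMulVec v x) (u - v) x (sub_ne_zero.2 huv) hx
      refine ⟨e, f, ?_⟩
      rw [add_assoc, ← add_vecMulVec, add_sub_cancel] at h
      simp only [h]
      abel)
  simpa only [Set.range_subset_iff] using this

end Dichotomy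

section Propagation

variable [Nonempty ι'] [Nonempty κ'] {A : Matrix ι κ D}

theorem col_of_row (hadj : ∀ A u x, u ≠ 0 → x ≠ 0 →
    ∃ u' x', u' ≠ 0 ∧ x' ≠ 0 ∧ θ (A + vecMulVec u x) = θ A + vecMulVec u' x')
    (hnd : ∀ u' x', u' ≠ 0 → x' ≠ 0 → ∃ u x, u ≠ 0 ∧ x ≠ 0 ∧
      θ (A + vecMulVec u x) - θ A ∉ rowLine κ' u' ∧ θ (A + vecMulVec u x) - θ A ∉ colLine ι' x')
    {u₀ : ι → D} (hu₀ : u₀ ≠ 0)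
    (h₀ : ∃ u', u' ≠ 0 ∧ ∀ x, θ (A + vecMulVec u₀ x) - θ A ∈ rowLine κ' u')
    {x : κ → D} (hx : x ≠ 0) :
    ∃ x', x' ≠ 0 ∧ ∀ u, θ (A + vecMulVec u x) - θ A ∈ colLine ι' x' := by
  obtain ⟨t, ⟨x', hx', rfl⟩, h⟩ := exists_mem_of_grid
    (M := {s | ∃ u', u' ≠ 0 ∧ s = rowLine κ' u'}) (N := {t | ∃ x', x' ≠ 0 ∧ t = colLine ι' x'})
    (by rintro _ ⟨u, -, rfl⟩ _ ⟨v, -, rfl⟩ B hB; exact rowLine_eq_of_mem hB)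
    (by rintro _ ⟨x, -, rfl⟩ _ ⟨y, -, rfl⟩ B hB; exact colLine_eq_of_mem hB)
    (fun (u : {u : ι → D // u ≠ 0}) (x : {x : κ → D // x ≠ 0}) =>
      θ (A + vecMulVec u.1 x.1) - θ A)
    (by
      rintro ⟨u, hu⟩ ⟨x, hx⟩
      obtain ⟨u', x', hu', hx', h⟩ := hadj A u x hu hx
      simp only [h, add_sub_cancel_left]
      exact vecMulVec_ne_zero_of_ne hu' hx')
    (by
      rintro ⟨u, hu⟩
      rcases row_dichotomy_of_adj hadj A hu with ⟨u', hu', h⟩ | ⟨x', hx', h⟩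
      · exact Or.inl ⟨_, ⟨u', hu', rfl⟩, fun x => h x.1⟩
      · exact Or.inr ⟨_, ⟨x', hx', rfl⟩, fun x => h x.1⟩)
    (by
      rintro ⟨x, hx⟩
      rcases col_dichotomy_of_adj hadj A hx with ⟨u', hu', h⟩ | ⟨x', hx', h⟩
      · exact Or.inl ⟨_, ⟨u', hu', rfl⟩, fun x => h x.1⟩
      · exact Or.inr ⟨_, ⟨x', hx', rfl⟩, fun x => h x.1⟩)
    (by
      rintro _ ⟨u', hu', rfl⟩ _ ⟨x', hx', rfl⟩
      obtain ⟨u, x, hu, hx, h⟩ := hnd u' x' hu' hx'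
      exact ⟨⟨u, hu⟩, ⟨x, hx⟩, h⟩)
    ⟨_, 1, one_ne_zero, rfl⟩ (u₀ := ⟨u₀, hu₀⟩)
    (by
      obtain ⟨u', hu', h⟩ := h₀
      exact ⟨_, ⟨u', hu', rfl⟩, fun x => h x.1⟩) ⟨x, hx⟩
  refine ⟨x', hx', fun u => ?_⟩
  by_cases hu : u = 0
  · rw [hu, zero_vecMulVec, add_zero, sub_self]
    exact zero_mem_colLine x'
  · exact h ⟨u, hu⟩

omit [Nonempty κ'] in
theorem row_of_col (hadj : ∀ A u x, u ≠ 0 → x ≠ 0 →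
    ∃ u' x', u' ≠ 0 ∧ x' ≠ 0 ∧ θ (A + vecMulVec u x) = θ A + vecMulVec u' x')
    (hnd : ∀ u' x', u' ≠ 0 → x' ≠ 0 → ∃ u x, u ≠ 0 ∧ x ≠ 0 ∧
      θ (A + vecMulVec u x) - θ A ∉ rowLine κ' u' ∧ θ (A + vecMulVec u x) - θ A ∉ colLine ι' x')
    {x₀ : κ → D} (hx₀ : x₀ ≠ 0)
    (h₀ : ∃ x', x' ≠ 0 ∧ ∀ u, θ (A + vecMulVec u x₀) - θ A ∈ colLine ι' x')
    {u : ι → D} (hu : u ≠ 0) :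
    ∃ u', u' ≠ 0 ∧ ∀ x, θ (A + vecMulVec u x) - θ A ∈ rowLine κ' u' := by
  obtain ⟨t, ⟨u', hu', rfl⟩, h⟩ := exists_mem_of_grid
    (N := {s | ∃ u', u' ≠ 0 ∧ s = rowLine κ' u'}) (M := {t | ∃ x', x' ≠ 0 ∧ t = colLine ι' x'})
    (by rintro _ ⟨x, -, rfl⟩ _ ⟨y, -, rfl⟩ B hB; exact colLine_eq_of_mem hB)
    (by rintro _ ⟨u, -, rfl⟩ _ ⟨v, -, rfl⟩ B hB; exact rowLine_eq_of_mem hB)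
    (fun (x : {x : κ → D // x ≠ 0}) (u : {u : ι → D // u ≠ 0}) =>
      θ (A + vecMulVec u.1 x.1) - θ A)
    (by
      rintro ⟨x, hx⟩ ⟨u, hu⟩
      obtain ⟨u', x', hu', hx', h⟩ := hadj A u x hu hx
      simp only [h, add_sub_cancel_left]
      exact vecMulVec_ne_zero_of_ne hu' hx')
    (by
      rintro ⟨x, hx⟩
      rcases col_dichotomy_of_adj hadj A hx with ⟨u', hu', h⟩ | ⟨x', hx', h⟩
      · exact Or.inr ⟨_, ⟨u', hu', rfl⟩, fun x => h x.1⟩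
      · exact Or.inl ⟨_, ⟨x', hx', rfl⟩, fun x => h x.1⟩)
    (by
      rintro ⟨u, hu⟩
      rcases row_dichotomy_of_adj hadj A hu with ⟨u', hu', h⟩ | ⟨x', hx', h⟩
      · exact Or.inr ⟨_, ⟨u', hu', rfl⟩, fun x => h x.1⟩
      · exact Or.inl ⟨_, ⟨x', hx', rfl⟩, fun x => h x.1⟩)
    (by
      rintro _ ⟨x', hx', rfl⟩ _ ⟨u', hu', rfl⟩
      obtain ⟨u, x, hu, hx, h⟩ := hnd u' x' hu' hx'
      exact ⟨⟨x, hx⟩, ⟨u, hu⟩, h.symm⟩)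
    ⟨_, 1, one_ne_zero, rfl⟩ (u₀ := ⟨x₀, hx₀⟩)
    (by
      obtain ⟨x', hx', h⟩ := h₀
      exact ⟨_, ⟨x', hx', rfl⟩, fun x => h x.1⟩) ⟨u, hu⟩
  refine ⟨u', hu', fun x => ?_⟩
  by_cases hx : x = 0
  · rw [hx, vecMulVec_zero_right, add_zero, sub_self]
    exact zero_mem_rowLine u'
  · exact h ⟨x, hx⟩

theorem isLocallyStandard_of_nondegenerate [Nonempty ι] [Nonempty κ]
    (hadj : ∀ A u x, u ≠ 0 → x ≠ 0 →
      ∃ u' x', u' ≠ 0 ∧ x' ≠ 0 ∧ θ (A + vecMulVec u x) = θ A + vecMulVec u' x')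
    (hnd : ∀ a b u' x', u' ≠ 0 → x' ≠ 0 → ∃ u x, u ≠ 0 ∧ x ≠ 0 ∧
      θ (vecMulVec a b + vecMulVec u x) - θ (vecMulVec a b) ∉ rowLine κ' u' ∧
      θ (vecMulVec a b + vecMulVec u x) - θ (vecMulVec a b) ∉ colLine ι' x')
    (h0 : θ 0 = 0) {u₀ : ι → D} (hu₀ : u₀ ≠ 0)
    (h₀ : ∃ u', u' ≠ 0 ∧ ∀ x, θ (vecMulVec u₀ x) ∈ rowLine κ' u') :
    IsLocallyStandard θ := by
  have hcol0 : ∀ x : κ → D, x ≠ 0 → ∃ x', x' ≠ 0 ∧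
      ∀ u, θ (vecMulVec 0 0 + vecMulVec u x) - θ (vecMulVec 0 0) ∈ colLine ι' x' := fun x hx =>
    col_of_row hadj (hnd 0 0) hu₀ (by simpa [h0] using h₀) hx
  have hrow0 : ∀ u : ι → D, u ≠ 0 → ∃ u', u' ≠ 0 ∧
      ∀ x, θ (vecMulVec 0 0 + vecMulVec u x) - θ (vecMulVec 0 0) ∈ rowLine κ' u' := fun u hu =>
    row_of_col hadj (hnd 0 0) one_ne_zero (hcol0 1 one_ne_zero) hu
  have hrow1 : ∀ a b, ∃ u : ι → D, u ≠ 0 ∧ ∃ u', u' ≠ 0 ∧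
      ∀ x, θ (vecMulVec a b + vecMulVec u x) - θ (vecMulVec a b) ∈ rowLine κ' u' := by
    intro a b
    by_cases ha : a = 0
    · subst ha
      exact ⟨1, one_ne_zero, by simpa using hrow0 1 one_ne_zero⟩
    · obtain ⟨u', hu', h⟩ := hrow0 a ha
      refine ⟨a, ha, u', hu', fun x => ?_⟩
      simp only [zero_vecMulVec, zero_add, h0, sub_zero] at h
      obtain ⟨r, hr⟩ := h (b + x)
      obtain ⟨s, hs⟩ := h b
      rw [← vecMulVec_add, hr, hs, ← vecMulVec_sub]
      exact ⟨_, rfl⟩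
  have hcol1 : ∀ a b, ∀ x : κ → D, x ≠ 0 → ∃ x', x' ≠ 0 ∧
      ∀ u, θ (vecMulVec a b + vecMulVec u x) - θ (vecMulVec a b) ∈ colLine ι' x' := by
    intro a b x hx
    obtain ⟨u, hu, h⟩ := hrow1 a b
    exact col_of_row hadj (hnd a b) hu h hx
  exact ⟨hadj, fun a b u hu => row_of_col hadj (hnd a b) one_ne_zero (hcol1 a b 1 one_ne_zero) hu,
    hcol1⟩

end Propagation

end Local

section RankOneFormula

variable {D D' : Type*} [DivisionRing D] [DivisionRing D'] {ι κ ι' κ' : Type*}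

/-- Pairwise proportional lineations preserving the axes share their ring homomorphism up to
conjugation. -/
theorem exists_ringHom_of_proportional
    (hD : ∀ a b c : D, ∃ d, d ≠ a ∧ d ≠ b ∧ d ≠ c) {I W : Type*} [Nonempty I] [Fintype κ]
    [DecidableEq κ] [Nontrivial κ] [AddCommGroup W] [Module D' W] {f : I → (κ → D) → W}
    (hf : ∀ i, IsLineation D D' (f i)) (hinj : ∀ i, Function.Injective (f i))
    (hf0 : ∀ i, f i 0 = 0) {e : κ → W} (he : LinearIndependent D' e)
    (hax : ∀ i j x, ∃ a : D', f i (Pi.single j x) = a • e j)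
    (hpar : ∀ i i' x, ∃ k : D', f i x = k • f i' x) :
    ∃ (τ : D →+* D') (c : I → D') (q : κ → D') (L : κ → I → D'), (∀ i, c i ≠ 0) ∧
      (∀ j, q j ≠ 0) ∧ ∀ i x, 1 + ∑ l, τ (x l) * L l i ≠ 0 ∧
        f i x = (c i * (1 + ∑ l, τ (x l) * L l i)⁻¹) • ∑ j, (τ (x j) * q j) • e j := by
  have key := fun i => (hf i).exists_ringHom hD (hinj i) (hf0 i) he (hax i)
  choose σ p w hp hw hfw using key
  obtain ⟨i₀⟩ := ‹Nonempty I›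
  have hcoord : ∀ i (x : κ → D), ∃ k : D', ∀ j, σ i (x j) * p i j = k * (σ i₀ (x j) * p i₀ j) := by
    intro i x
    obtain ⟨k, hk⟩ := hpar i i₀ x
    refine ⟨(1 + ∑ j, σ i (x j) * w i j) * k * (1 + ∑ j, σ i₀ (x j) * w i₀ j)⁻¹, fun j => ?_⟩
    rw [hfw i x, hfw i₀ x, smul_smul, inv_smul_eq_iff₀ (hw i x), smul_smul, Finset.smul_sum] at hk
    simp only [smul_smul] at hk
    have := LinearIndependent.eq_coords_of_eq he hk j
    simpa [mul_assoc] using this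
  have h1 : ∀ i, ∃ c : D', c ≠ 0 ∧ ∀ j, p i j = c * p i₀ j := by
    intro i
    obtain ⟨k, hk⟩ := hcoord i 1
    simp only [Pi.one_apply, map_one, one_mul] at hk
    obtain ⟨j, -⟩ := exists_pair_ne κ
    exact ⟨k, fun h => hp i j (by rw [hk, h, zero_mul]), hk⟩
  choose c hc hpc using h1
  have hσ : ∀ i s, σ i s * c i = c i * σ i₀ s := by
    intro i s
    obtain ⟨j, l, hjl⟩ := exists_pair_ne κ
    obtain ⟨k, hk⟩ := hcoord i (Function.update 1 j s)
    have hl := hk l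
    have hj := hk j
    rw [Function.update_of_ne hjl.symm, Pi.one_apply, map_one, map_one, one_mul, one_mul, hpc] at hl
    rw [Function.update_self, ← mul_right_cancel₀ (hp i₀ l) hl, hpc, ← mul_assoc, ← mul_assoc] at hj
    exact mul_right_cancel₀ (hp i₀ j) hj
  refine ⟨σ i₀, c, p i₀, fun l i => (c i)⁻¹ * w i l * c i, hc, hp i₀, fun i x => ?_⟩
  have hsum : c i * (1 + ∑ l, σ i₀ (x l) * ((c i)⁻¹ * w i l * c i)) =
      (1 + ∑ l, σ i (x l) * w i l) * c i := by
    rw [mul_add, add_mul, mul_one, one_mul, Finset.mul_sum, Finset.sum_mul]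
    congr 1
    refine Finset.sum_congr rfl fun l _ => ?_
    rw [← mul_assoc, ← hσ]
    simp only [mul_assoc, mul_inv_cancel_left₀ (hc i)]
  have hne : 1 + ∑ l, σ i₀ (x l) * ((c i)⁻¹ * w i l * c i) ≠ 0 := by
    intro h
    rw [h, mul_zero] at hsum
    exact mul_ne_zero (hw i x) (hc i) hsum.symm
  refine ⟨hne, ?_⟩
  rw [hfw, inv_smul_eq_iff₀ (hw i x), smul_smul, ← mul_assoc, ← hsum, mul_assoc,
    mul_inv_cancel₀ hne, mul_one, Finset.smul_sum]
  refine Finset.sum_congr rfl fun j _ => ?_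
  rw [smul_smul, hpc, ← mul_assoc, hσ, mul_assoc]

theorem linearIndependent_single_of_injective {S M : Type*} [Ring S] [AddCommGroup M] [Module S M]
    [DecidableEq κ'] {g : κ → κ'} (hg : Function.Injective g) {c : κ → M}
    (hc : ∀ i (s : S), s • c i = 0 → s = 0) :
    LinearIndependent S fun i => Pi.single (M := fun _ => M) (g i) (c i) := by
  classical
  rw [linearIndependent_iff']
  intro s a h i hi
  have h1 := congrFun h (g i)
  rw [Finset.sum_apply, Finset.sum_eq_single_of_mem i hi] at h1
  · exact hc i _ (by simpa using h1)
  · intro j _ hj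
    rw [Pi.smul_apply, Pi.single_eq_of_ne (fun h => hj (hg h).symm), smul_zero]

variable {θ : Matrix ι κ D → Matrix ι' κ' D'}

namespace IsLocallyStandard

theorem injective_of_row (h : IsLocallyStandard θ) {u : ι → D} (hu : u ≠ 0) {u' : ι' → D'}
    {f : (κ → D) → κ' → D'} (hf : ∀ x, θ (vecMulVec u x) = vecMulVec u' (f x)) :
    Function.Injective f := by
  intro x y hxy
  by_contra hne
  obtain ⟨v, z, hv, hz, h1⟩ := h.adj (vecMulVec u x) u (y - x) hu (sub_ne_zero.2 (Ne.symm hne))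
  rw [← vecMulVec_add, add_sub_cancel, hf, hf, hxy, left_eq_add] at h1
  exact vecMulVec_ne_zero_of_ne hv hz h1

theorem injective_of_col (h : IsLocallyStandard θ) {x : κ → D} (hx : x ≠ 0) {x' : κ' → D'}
    {f : (ι → D) → ι' → D'} (hf : ∀ u, θ (vecMulVec u x) = vecMulVec (f u) x') :
    Function.Injective f := by
  intro u y huy
  by_contra hne
  obtain ⟨v, z, hv, hz, h1⟩ := h.adj (vecMulVec u x) (y - u) x (sub_ne_zero.2 (Ne.symm hne)) hx
  rw [← add_vecMulVec, add_sub_cancel, hf, hf, huy, left_eq_add] at h1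
  exact vecMulVec_ne_zero_of_ne hv hz h1

theorem isLineation_of_row (h : IsLocallyStandard θ) {u : ι → D} (hu : u ≠ 0) {u' : ι' → D'}
    (hu' : u' ≠ 0) {f : (κ → D) → κ' → D'} (hf : ∀ x, θ (vecMulVec u x) = vecMulVec u' (f x)) :
    IsLineation D D' f := by
  intro y z r
  by_cases hzy : z = y
  · exact ⟨0, by simp [hzy]⟩
  obtain ⟨x', -, hx'⟩ := h.col u y (z - y) (sub_ne_zero.2 hzy)
  obtain ⟨i, hi⟩ := Function.ne_iff.1 hu'
  rw [Pi.zero_apply] at hi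
  have key : ∀ s : D, ∃ c : D', f (y + s • (z - y)) - f y = c • x' := by
    intro s
    obtain ⟨c, hc⟩ := hx' fun i => u i * s
    rw [vecMulVec_mul_right_eq, ← vecMulVec_add, hf, hf, ← vecMulVec_sub] at hc
    refine ⟨(u' i)⁻¹ * c i, funext fun j => ?_⟩
    have := congrFun (congrFun hc i) j
    rw [vecMulVec_apply, vecMulVec_apply] at this
    rw [Pi.smul_apply, smul_eq_mul, mul_assoc, ← this, inv_mul_cancel_left₀ hi]
  obtain ⟨c, hc⟩ := key r
  obtain ⟨d, hd⟩ := key 1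
  rw [one_smul, add_sub_cancel] at hd
  have hd0 : d ≠ 0 := by
    rintro rfl
    rw [zero_smul, sub_eq_zero] at hd
    exact hzy (h.injective_of_row hu hf hd)
  refine ⟨c * d⁻¹, ?_⟩
  rw [hd, smul_smul, mul_assoc, inv_mul_cancel₀ hd0, mul_one, ← hc, add_sub_cancel]

theorem isLineation_of_col (h : IsLocallyStandard θ) {x : κ → D} (hx : x ≠ 0) {x' : κ' → D'}
    (hx' : x' ≠ 0) {f : (ι → D) → ι' → D'} (hf : ∀ u, θ (vecMulVec u x) = vecMulVec (f u) x') :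
    IsLineation Dᵐᵒᵖ D'ᵐᵒᵖ fun u : ι → Dᵐᵒᵖ => f fun i => (u i).unop := by
  intro y z r
  by_cases hzy : z = y
  · exact ⟨0, by simp [hzy]⟩
  have hzy' : (fun i => (z i).unop) ≠ fun i => (y i).unop := fun H =>
    hzy (funext fun i => MulOpposite.unop_injective (congrFun H i))
  obtain ⟨u', -, hu'⟩ := h.row (fun i => (y i).unop) x
    ((fun i => (z i).unop) - fun i => (y i).unop) (sub_ne_zero.2 hzy')
  obtain ⟨j, hj⟩ := Function.ne_iff.1 hx'
  rw [Pi.zero_apply] at hj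
  have key : ∀ s : Dᵐᵒᵖ, ∃ c : D', ∀ i, (f (fun i => ((y + s • (z - y)) i).unop) -
      f fun i => (y i).unop) i = u' i * c := by
    intro s
    obtain ⟨c, hc⟩ := hu' (s.unop • x)
    rw [← vecMulVec_mul_right_eq, ← add_vecMulVec, hf, hf, ← sub_vecMulVec] at hc
    refine ⟨c j * (x' j)⁻¹, fun i => ?_⟩
    have := congrFun (congrFun hc i) j
    rw [vecMulVec_apply, vecMulVec_apply] at this
    rw [← mul_assoc, eq_mul_inv_iff_mul_eq₀ hj, ← this]
    rfl
  obtain ⟨c, hc⟩ := key r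
  obtain ⟨d, hd⟩ := key 1
  rw [one_smul, add_sub_cancel] at hd
  have hd0 : d ≠ 0 := by
    rintro rfl
    refine hzy' (h.injective_of_col hx hf (sub_eq_zero.1 (funext fun i => ?_)))
    rw [hd, mul_zero, Pi.zero_apply]
  refine ⟨MulOpposite.op (d⁻¹ * c), funext fun i => ?_⟩
  rw [Pi.add_apply, Pi.smul_apply, op_smul_eq_mul, hd, mul_assoc,
    mul_inv_cancel_left₀ hd0, ← hc, Pi.sub_apply, add_sub_cancel]

end IsLocallyStandard

/-- The matrix of the linear map sending the `i`-th basis vector to `c i` times the `g i`-th one. -/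
def scaledEmbedding {R : Type*} [Zero R] [DecidableEq ι'] (g : ι → ι') (c : ι → R) :
    Matrix ι' ι R :=
  of fun i' i => Pi.single (M := fun _ => R) (g i) (c i) i'

theorem scaledEmbedding_mulVec {R : Type*} [Semiring R] [Fintype ι] [DecidableEq ι']
    (g : ι → ι') (c u : ι → R) :
    scaledEmbedding g c *ᵥ u = ∑ i, Pi.single (M := fun _ => R) (g i) (c i * u i) := by
  ext i'
  rw [Finset.sum_apply]
  refine Finset.sum_congr rfl fun i _ => ?_
  simp [scaledEmbedding, Pi.single_apply]

theorem vecMul_scaledEmbedding_transpose {R : Type*} [Semiring R] [Fintype κ] [DecidableEq κ']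
    (g : κ → κ') (q x : κ → R) :
    x ᵥ* (scaledEmbedding g q)ᵀ = ∑ j, (x j * q j) • Pi.single (M := fun _ => R) (g j) 1 := by
  ext j'
  rw [Finset.sum_apply]
  refine Finset.sum_congr rfl fun j _ => ?_
  simp [scaledEmbedding, Pi.single_apply]

theorem scaledEmbedding_mul_left {R : Type*} [DivisionRing R] [Fintype ι'] [DecidableEq ι]
    [DecidableEq ι'] {g : ι → ι'} (hg : Function.Injective g) {c : ι → R} (hc : ∀ i, c i ≠ 0) :
    (scaledEmbedding g fun i => (c i)⁻¹)ᵀ * scaledEmbedding g c = 1 := by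
  ext i k
  rw [mul_apply, Finset.sum_eq_single_of_mem (g i) (Finset.mem_univ _)]
  · by_cases h : i = k
    · subst h
      simp [scaledEmbedding, hc]
    · simp [scaledEmbedding, h, Pi.single_eq_of_ne (fun H => h (hg H))]
  · intro j _ hj
    simp [scaledEmbedding, hj]

theorem mul_scaledEmbedding_transpose {R : Type*} [DivisionRing R] [Fintype ι'] [DecidableEq ι]
    [DecidableEq ι'] {g : ι → ι'} (hg : Function.Injective g) {c : ι → R} (hc : ∀ i, c i ≠ 0) :
    (scaledEmbedding g c)ᵀ * scaledEmbedding g (fun i => (c i)⁻¹) = 1 := by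
  simpa using scaledEmbedding_mul_left hg (c := fun i => (c i)⁻¹) fun i => inv_ne_zero (hc i)

theorem inv_one_add_mul_mul {R : Type*} [DivisionRing R] {a b : R} (h : 1 + a * b ≠ 0) :
    (1 + a * b)⁻¹ * a = a * (1 + b * a)⁻¹ := by
  have h1 : (1 + a * b) * a = a * (1 + b * a) := by noncomm_ring
  have h2 : 1 + b * a ≠ 0 := by
    intro h2
    rw [h2, mul_zero] at h1
    rw [(mul_eq_zero.1 h1).resolve_left h, mul_zero, add_zero] at h2
    exact one_ne_zero h2
  rw [inv_mul_eq_iff_eq_mul₀ h, ← mul_assoc, h1, mul_assoc, mul_inv_cancel₀ h2, mul_one]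

/-- A locally standard map preserving the coordinate rows and columns is given on matrices of rank
one by a fractional formula. -/
theorem IsLocallyStandard.exists_formula_vecMulVec
    (hD : ∀ a b c : D, ∃ d, d ≠ a ∧ d ≠ b ∧ d ≠ c) [Fintype ι] [DecidableEq ι] [Nontrivial ι]
    [Fintype κ] [DecidableEq κ] [Nontrivial κ] [DecidableEq ι'] [DecidableEq κ']
    (h : IsLocallyStandard θ) (h0 : θ 0 = 0) {gι : ι → ι'} (hgι : Function.Injective gι)
    {gκ : κ → κ'} (hgκ : Function.Injective gκ)
    (hrow : ∀ i x, θ (vecMulVec (Pi.single i 1) x) ∈ rowLine κ' (Pi.single (gι i) 1))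
    (hcol : ∀ j u, θ (vecMulVec u (Pi.single j 1)) ∈ colLine ι' (Pi.single (gκ j) 1)) :
    ∃ (τ : D →+* D') (c : ι → D') (q : κ → D') (L : Matrix κ ι D'), (∀ i, c i ≠ 0) ∧
      (∀ j, q j ≠ 0) ∧ ∀ u x, 1 + (τ ∘ x) ⬝ᵥ (L *ᵥ (τ ∘ u)) ≠ 0 ∧
        θ (vecMulVec u x) = vecMulVec (scaledEmbedding gι c *ᵥ (τ ∘ u))
          ((1 + (τ ∘ x) ⬝ᵥ (L *ᵥ (τ ∘ u)))⁻¹ • ((τ ∘ x) ᵥ* (scaledEmbedding gκ q)ᵀ)) := by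
  choose f hf using hrow
  have hι : ∀ i : ι, (Pi.single i 1 : ι → D) ≠ 0 := fun i => by simp
  have hι' : ∀ i : ι', (Pi.single i 1 : ι' → D') ≠ 0 := fun i => by simp
  have hinj := fun i => h.injective_of_row (hι i) (hf i)
  have hf0 : ∀ i, f i 0 = 0 := by
    intro i
    have := hf i 0
    rw [vecMulVec_zero_right, h0] at this
    by_contra hne
    exact vecMulVec_ne_zero_of_ne (hι' _) hne this.symm
  have hcolx : ∀ x, x ≠ 0 → ∃ x', x' ≠ 0 ∧ ∀ u, θ (vecMulVec u x) ∈ colLine ι' x' := by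
    intro x hx
    obtain ⟨x', hx', H⟩ := h.col 0 0 x hx
    refine ⟨x', hx', fun u => ?_⟩
    simpa [h0] using H u
  have hpar : ∀ i x x', θ (vecMulVec (Pi.single i 1) x) ∈ colLine ι' x' →
      ∃ k : D', f i x = k • x' := by
    intro i x x' hx'
    rw [hf] at hx'
    obtain ⟨k, hk⟩ := hx'
    refine ⟨k (gι i), funext fun j => ?_⟩
    simpa [vecMulVec_apply] using congrFun (congrFun hk (gι i)) j
  obtain ⟨τ, c, q, L, hc, hq, hfL⟩ := exists_ringHom_of_proportional hD
    (fun i => h.isLineation_of_row (hι i) (hι' _) (hf i)) hinj hf0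
    (linearIndependent_single_of_injective (S := D') hgκ (c := fun _ => (1 : D'))
      fun _ _ hs => by simpa using hs)
    (fun i j x => hpar i _ _ (by
      rw [← mul_one x, ← smul_eq_mul, Pi.single_smul', ← vecMulVec_mul_right_eq]
      exact hcol j _))
    (fun i i' x => by
      by_cases hx : x = 0
      · exact ⟨0, by rw [hx, hf0, zero_smul]⟩
      obtain ⟨x', hx', H⟩ := hcolx x hx
      obtain ⟨k, hk⟩ := hpar i x x' (H _)
      obtain ⟨k', hk'⟩ := hpar i' x x' (H _)
      have hk0 : k' ≠ 0 := by
        rintro rfl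
        rw [zero_smul, ← hf0 i'] at hk'
        exact hx (hinj i' hk')
      exact ⟨k * k'⁻¹, by rw [hk, hk', smul_smul, mul_assoc, inv_mul_cancel₀ hk0, mul_one]⟩)
  refine ⟨τ, c, q, of L, hc, hq, fun u x => ?_⟩
  by_cases hx : x = 0
  · simp [hx, vecMulVec_zero_right, h0]
  set x' := (τ ∘ x) ᵥ* (scaledEmbedding gκ q)ᵀ with hx'
  set y := (τ ∘ x) ᵥ* of L with hy
  have hfx : ∀ i s, 1 + τ s * y i ≠ 0 ∧ f i (s • x) = (c i * (1 + τ s * y i)⁻¹ * τ s) • x' := by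
    intro i s
    have hsum : ∑ l, τ ((s • x) l) * L l i = τ s * y i := by
      rw [hy, vecMul, dotProduct, Finset.mul_sum]
      simp [mul_assoc]
    obtain ⟨h1, h2⟩ := hfL i (s • x)
    rw [hsum] at h1 h2
    refine ⟨h1, ?_⟩
    rw [h2, hx', vecMul_scaledEmbedding_transpose]
    simp only [Finset.smul_sum, smul_smul, mul_assoc, Pi.smul_apply, smul_eq_mul, map_mul,
      Function.comp_apply]
  have hx'0 : x' ≠ 0 := by
    obtain ⟨i, -⟩ := exists_pair_ne ι
    intro H
    have := (hfx i 1).2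
    rw [H, smul_zero, one_smul, ← hf0 i] at this
    exact hx (hinj i this)
  have hψ : ∀ u, ∃ v, θ (vecMulVec u x) = vecMulVec v x' := by
    obtain ⟨i, -⟩ := exists_pair_ne ι
    obtain ⟨z, hz, H⟩ := hcolx x hx
    obtain ⟨k, hk⟩ := hpar i x z (H _)
    have h1 := (hfx i 1).2
    have h2 : c i * (1 + τ 1 * y i)⁻¹ * τ 1 ≠ 0 :=
      mul_ne_zero (mul_ne_zero (hc i) (inv_ne_zero (hfx i 1).1)) (by simp)
    rw [one_smul, hk, eq_comm, ← eq_inv_smul_iff₀ h2, smul_smul] at h1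
    have hk0 : (c i * (1 + τ 1 * y i)⁻¹ * τ 1)⁻¹ * k ≠ 0 := by
      intro H
      rw [H, zero_smul] at h1
      exact hx'0 h1
    intro u
    have := H u
    rwa [← colLine_eq_of_mul_left hk0 h1] at this
  choose ψ hψ using hψ
  have hψs : ∀ i s, ψ (Pi.single i s) = Pi.single (gι i) (c i * ((1 + τ s * y i)⁻¹ * τ s)) := by
    intro i s
    have h1 := hψ (Pi.single i s)
    have h2 : (Pi.single i s : ι → D) = fun k => (Pi.single i 1 : ι → D) k * s := by
      ext k
      simp [Pi.single_apply]
    rw [h2, vecMulVec_mul_right_eq, hf, (hfx i s).2, ← vecMulVec_mul_right_eq, ← h2] at h1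
    obtain ⟨j, hj⟩ := Function.ne_iff.1 hx'0
    ext k
    have h3 := mul_right_cancel₀ hj (congrFun (congrFun h1 k) j)
    rw [← h3]
    simp [Pi.single_apply, mul_assoc]
  have hDop : ∀ a b d : Dᵐᵒᵖ, ∃ t, t ≠ a ∧ t ≠ b ∧ t ≠ d := by
    intro a b d
    obtain ⟨t, h1, h2, h3⟩ := hD a.unop b.unop d.unop
    exact ⟨.op t, fun H => h1 (by rw [← H]; rfl), fun H => h2 (by rw [← H]; rfl),
      fun H => h3 (by rw [← H]; rfl)⟩
  have hsingle : ∀ i (s : Dᵐᵒᵖ), (fun k => ((Pi.single i s : ι → Dᵐᵒᵖ) k).unop) =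
      Pi.single i s.unop := by
    intro i s
    ext k
    rw [Pi.single_apply, Pi.single_apply]
    split_ifs <;> rfl
  obtain ⟨σ, ρ, w, hρ, hσ⟩ := (h.isLineation_of_col hx hx'0 hψ).exists_ringHom hDop
    (fun a b hab => funext fun i => MulOpposite.unop_injective
      (congrFun (h.injective_of_col hx hψ hab) i))
    (by
      obtain ⟨i, -⟩ := exists_pair_ne ι
      have := hψs i 0
      rw [Pi.single_zero, map_zero, mul_zero, mul_zero, Pi.single_zero] at this
      exact this)
    (linearIndependent_single_of_injective (S := D'ᵐᵒᵖ) hgι (c := c)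
      fun i s hs => by simpa [MulOpposite.smul_eq_mul_unop, hc i] using hs)
    (fun i s => ⟨.op ((1 + τ s.unop * y i)⁻¹ * τ s.unop), by
      rw [hsingle, hψs]
      ext k
      simp [Pi.single_apply]⟩)
  have huniq : ∀ i, τ.op = σ ∧ 1 = ρ i ∧ .op (y i) = w i := by
    intro i
    refine ringHom_eq_of_axis_eq hDop one_ne_zero fun s => ?_
    have h1 := (hσ (Pi.single i s)).2
    have h2 : ∀ v : ι → D'ᵐᵒᵖ, ∑ j, σ ((Pi.single i s : ι → Dᵐᵒᵖ) j) * v j = σ s * v i := by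
      intro v
      rw [Finset.sum_eq_single_of_mem i (Finset.mem_univ _) fun j _ hj => by simp [hj],
        Pi.single_eq_same]
    have h3 : ∑ j, (σ ((Pi.single i s : ι → Dᵐᵒᵖ) j) * ρ j) •
        Pi.single (M := fun _ => D') (gι j) (c j) = (σ s * ρ i) • Pi.single (gι i) (c i) := by
      rw [Finset.sum_eq_single_of_mem i (Finset.mem_univ _) fun j _ hj => by simp [hj],
        Pi.single_eq_same]
    rw [hsingle, hψs, h2, h3] at h1
    have h4 := congrFun h1 (gι i)
    rw [smul_smul, Pi.smul_apply, Pi.single_eq_same, Pi.single_eq_same,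
      MulOpposite.smul_eq_mul_unop] at h4
    apply MulOpposite.unop_injective
    rw [← mul_left_cancel₀ (hc i) h4, inv_one_add_mul_mul (hfx i s.unop).1]
    simp
  obtain ⟨h1, h2⟩ := hσ fun i => .op (u i)
  have h3 : 1 + ∑ j, σ (.op (u j)) * w j = .op (1 + y ⬝ᵥ (τ ∘ u)) := by
    rw [dotProduct, MulOpposite.op_add, MulOpposite.op_one, Finset.op_sum]
    congr 1
    refine Finset.sum_congr rfl fun j _ => ?_
    rw [← (huniq j).1, ← (huniq j).2.2]
    rfl
  have h4 : ∑ j, (σ (.op (u j)) * ρ j) • Pi.single (M := fun _ => D') (gι j) (c j) =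
      scaledEmbedding gι c *ᵥ (τ ∘ u) := by
    rw [scaledEmbedding_mulVec]
    refine Finset.sum_congr rfl fun j _ => ?_
    rw [← (huniq j).1, ← (huniq j).2.1]
    ext k
    simp [Pi.single_apply]
  rw [h3] at h1 h2
  rw [h4] at h2
  rw [dotProduct_mulVec]
  refine ⟨fun H => h1 (by rw [H]; rfl), ?_⟩
  have h5 : ψ u = fun i => (scaledEmbedding gι c *ᵥ (τ ∘ u)) i * (1 + y ⬝ᵥ (τ ∘ u))⁻¹ := h2
  rw [hψ, h5, vecMulVec_mul_right_eq]

end RankOneFormula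

section RankInduction

variable {D D' : Type*} [DivisionRing D] [DivisionRing D'] {ι κ ι' κ' : Type*}

/-- The sums of `k` matrices of rank at most one. -/
def sumsOfRankOne : ℕ → Set (Matrix ι κ D)
  | 0 => {0}
  | k + 1 => {X | ∃ Z ∈ sumsOfRankOne k, ∃ u x, X = Z + vecMulVec u x}

theorem exists_mem_sumsOfRankOne [Fintype ι] (X : Matrix ι κ D) : ∃ k, X ∈ sumsOfRankOne k := by
  classical
  have key : ∀ s : Finset ι, ∑ i ∈ s, vecMulVec (Pi.single i 1) (X i) ∈ sumsOfRankOne s.card := by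
    intro s
    induction s using Finset.induction_on with
    | empty => simp [sumsOfRankOne]
    | insert i s hi ih =>
      rw [Finset.card_insert_of_notMem hi, Finset.sum_insert hi,
        add_comm (vecMulVec _ _)]
      exact ⟨_, ih, _, _, rfl⟩
  suffices h : ∑ i, vecMulVec (Pi.single i 1) (X i) = X from ⟨_, h ▸ key Finset.univ⟩
  ext i j
  rw [Matrix.sum_apply, Finset.sum_eq_single_of_mem i (Finset.mem_univ _)]
  · simp [vecMulVec_apply]
  · intro k _ hk
    simp [vecMulVec_apply, hk.symm]

section Algebra

variable [Fintype ι'] [Fintype κ'] [DecidableEq ι'] [DecidableEq κ'] {L : Matrix κ' ι' D'}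
  {A B A₁ B₁ : Matrix ι' κ' D'}

theorem mul_one_sub_of_one_add_mul (h : (1 + A * L) * B = A) : A * (1 - L * B) = B := by
  rw [Matrix.mul_sub, Matrix.mul_one, sub_eq_iff_eq_add', ← Matrix.mul_assoc]
  rw [Matrix.add_mul, Matrix.one_mul, add_comm] at h
  exact h.symm

omit [DecidableEq κ'] in
theorem one_add_mul_one_sub (h : (1 + A * L) * B = A) : (1 + A * L) * (1 - B * L) = 1 := by
  rw [Matrix.mul_sub, ← Matrix.mul_assoc, h, Matrix.mul_one, add_sub_cancel_right]

omit [DecidableEq κ'] in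
theorem one_sub_mul_one_add (h : (1 + A * L) * B = A) : (1 - B * L) * (1 + A * L) = 1 :=
  mul_eq_one_comm.1 (one_add_mul_one_sub h)

omit [DecidableEq κ'] in
theorem one_sub_mul_of_one_add_mul (h : (1 + A * L) * B = A) : (1 - B * L) * A = B := by
  conv_lhs => rw [← h]
  rw [← Matrix.mul_assoc, one_sub_mul_one_add h, Matrix.one_mul]

theorem one_sub_mul_one_add' (h : (1 + A * L) * B = A) : (1 - L * B) * (1 + L * A) = 1 := by
  have h1 : (1 + L * A) * (1 - L * B) = 1 := by
    rw [Matrix.add_mul, Matrix.mul_assoc, mul_one_sub_of_one_add_mul h, Matrix.one_mul,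
      sub_add_cancel]
  exact mul_eq_one_comm.1 h1

theorem sub_eq_one_sub_mul_sub_mul (h : (1 + A * L) * B = A) (h₁ : (1 + A₁ * L) * B₁ = A₁) :
    B₁ - B = (1 - B * L) * (A₁ - A) * (1 - L * B₁) := by
  rw [Matrix.mul_sub (1 - B * L), one_sub_mul_of_one_add_mul h, Matrix.sub_mul, Matrix.mul_assoc,
    mul_one_sub_of_one_add_mul h₁, Matrix.sub_mul, Matrix.mul_sub, Matrix.one_mul, Matrix.mul_one,
    Matrix.mul_assoc]
  abel

theorem sub_mem_rowLine {u : ι' → D'} {v : κ' → D'} (h : (1 + A * L) * B = A)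
    (h₁ : (1 + A₁ * L) * B₁ = A₁) (hA : A₁ - A = vecMulVec u v) :
    B₁ - B ∈ rowLine κ' ((1 - B * L) *ᵥ u) := by
  rw [sub_eq_one_sub_mul_sub_mul h h₁, hA, mul_vecMulVec, vecMulVec_mul]
  exact ⟨_, rfl⟩

theorem sub_mem_colLine {u : ι' → D'} {v : κ' → D'} (h : (1 + A * L) * B = A)
    (h₁ : (1 + A₁ * L) * B₁ = A₁) (hA : A₁ - A = vecMulVec u v) :
    B₁ - B ∈ colLine ι' (v ᵥ* (1 - L * B)) := by
  have hA' : A - A₁ = vecMulVec (-u) v := by rw [← neg_sub, hA, neg_vecMulVec]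
  rw [← neg_sub B, sub_eq_one_sub_mul_sub_mul h₁ h, hA', mul_vecMulVec, vecMulVec_mul,
    ← neg_vecMulVec]
  exact ⟨_, rfl⟩

omit [DecidableEq κ'] in
theorem defect_mem_rowLine {u : ι' → D'} {v : κ' → D'} (h : (1 + A * L) * B = A)
    (hA : A₁ - A = vecMulVec u v) (hB : B₁ - B ∈ rowLine κ' ((1 - B * L) *ᵥ u)) :
    (1 + A₁ * L) * B₁ - A₁ ∈ rowLine κ' u := by
  obtain ⟨r, hr⟩ := hB
  rw [sub_eq_iff_eq_add'] at hA hr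
  have h1 : (1 + A * L) * vecMulVec ((1 - B * L) *ᵥ u) r = vecMulVec u r := by
    rw [mul_vecMulVec, mulVec_mulVec, one_add_mul_one_sub h, one_mulVec]
  have h2 : (1 + A₁ * L) * B₁ = A + vecMulVec u r + vecMulVec u (v ᵥ* (L * B₁)) := by
    rw [← vecMulVec_mul, ← h1]
    conv_rhs => enter [1, 1]; rw [← h]
    rw [← Matrix.mul_add, ← hr, hA]
    simp only [Matrix.add_mul, Matrix.mul_assoc]
    abel
  refine ⟨r + v ᵥ* (L * B₁) - v, ?_⟩
  rw [h2, hA, vecMulVec_sub, vecMulVec_add]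
  abel

end Algebra

section Defect

variable [Fintype ι'] [Fintype κ'] [DecidableEq ι'] [DecidableEq κ']
  {θ : Matrix ι κ D → Matrix ι' κ' D'} {L : Matrix κ' ι' D'} {hat : Matrix ι κ D →+ Matrix ι' κ' D'}
  {a : (ι → D) → ι' → D'} {b : (κ → D) → κ' → D'}

omit [DecidableEq ι'] [DecidableEq κ'] [Fintype ι'] [Fintype κ'] in
theorem eq_zero_of_mem_rowLine {u v : ι' → D'} {A : Matrix ι' κ' D'} (hu : A ∈ rowLine κ' u)
    (hv : A ∈ rowLine κ' v) (huv : ¬ ∃ k, ∀ i, u i = v i * k) : A = 0 := by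
  by_contra hA
  obtain ⟨k, -, hk⟩ := exists_eq_mul_right_of_mem_rowLine hA hu hv
  exact huv ⟨k, hk⟩

theorem IsLocallyStandard.defect_mem_rowLine_of_two (h : IsLocallyStandard θ)
    (hab : ∀ u x, hat (vecMulVec u x) = vecMulVec (a u) (b x))
    (hb : ∀ x y, (∃ k : D', b x = k • b y) → ∃ k : D, x = k • y) {Z : Matrix ι κ D} {u : ι → D}
    {x y z : κ → D} (hu : u ≠ 0) (hx : x ≠ 0) (hy : y ≠ 0) (hz : z ≠ 0) (hxy : x ≠ y)
    (hxz : x ≠ z) (hyz : ¬ ∃ k : D, y = k • z) (hZ : (1 + hat Z * L) * θ Z = hat Z)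
    (hZy : (1 + hat (Z + vecMulVec u y) * L) * θ (Z + vecMulVec u y) = hat (Z + vecMulVec u y))
    (hZz : (1 + hat (Z + vecMulVec u z) * L) * θ (Z + vecMulVec u z) = hat (Z + vecMulVec u z)) :
    (1 + hat (Z + vecMulVec u x) * L) * θ (Z + vecMulVec u x) - hat (Z + vecMulVec u x) ∈
      rowLine κ' (a u) := by
  have hhat : ∀ x, hat (Z + vecMulVec u x) - hat Z = vecMulVec (a u) (b x) := fun x => by
    rw [map_add, hab, add_sub_cancel_left]
  refine defect_mem_rowLine hZ (hhat x) ?_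
  obtain ⟨p, r, hp, hr, hpr⟩ := h.adj Z u x hu hx
  rw [← sub_eq_iff_eq_add'] at hpr
  have key : ∀ w, w ≠ 0 → x ≠ w →
      (1 + hat (Z + vecMulVec u w) * L) * θ (Z + vecMulVec u w) = hat (Z + vecMulVec u w) →
      θ (Z + vecMulVec u x) - θ Z ∈ rowLine κ' ((1 - θ Z * L) *ᵥ a u) ∨
        θ (Z + vecMulVec u x) - θ Z ∈ colLine ι' (b w ᵥ* (1 - L * θ Z)) := by
    intro w hw hxw hZw
    obtain ⟨p', r', hp', hr', h1⟩ := h.adj Z u w hu hw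
    rw [← sub_eq_iff_eq_add'] at h1
    obtain ⟨e, f, -, -, h2⟩ := h.adj (Z + vecMulVec u w) u (x - w) hu (sub_ne_zero.2 hxw)
    rw [add_assoc, ← vecMulVec_add, add_sub_cancel, ← sub_eq_iff_eq_add',
      ← sub_sub_sub_cancel_right _ _ (θ Z), hpr, h1] at h2
    have hrow := sub_mem_rowLine hZ hZw (hhat w)
    have hcol := sub_mem_colLine hZ hZw (hhat w)
    rw [h1] at hrow hcol
    have hne : vecMulVec p' r' ≠ 0 := vecMulVec_ne_zero_of_ne hp' hr'
    rw [hpr, ← rowLine_eq_of_mem hne ⟨r', rfl⟩ hrow, ← colLine_eq_of_mem hne ⟨p', rfl⟩ hcol]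
    exact mem_rowLine_or_mem_colLine h2 hp' hr'
  rcases key y hy hxy hZy with h1 | h1
  · exact h1
  rcases key z hz hxz hZz with h2 | h2
  · exact h2
  exfalso
  rw [hpr] at h1 h2
  obtain ⟨k, -, hk⟩ := exists_eq_mul_left_of_mem_colLine (vecMulVec_ne_zero_of_ne hp hr) h1 h2
  refine hyz (hb y z ⟨k, ?_⟩)
  have := congrArg (· ᵥ* (1 + L * hat Z)) hk
  simpa only [smul_vecMul, vecMul_vecMul, one_sub_mul_one_add' hZ, vecMul_one] using this

theorem IsLocallyStandard.defect_mem_rowLine_of_vecMulVec (h : IsLocallyStandard θ)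
    (hab : ∀ u x, hat (vecMulVec u x) = vecMulVec (a u) (b x)) {c : ι → D} {d : κ → D} {u : ι → D}
    {x y : κ → D} (hu : u ≠ 0) (hy : y ≠ 0)
    (hZ : (1 + hat (vecMulVec c d) * L) * θ (vecMulVec c d) = hat (vecMulVec c d))
    (hZy : (1 + hat (vecMulVec c d + vecMulVec u y) * L) * θ (vecMulVec c d + vecMulVec u y) =
      hat (vecMulVec c d + vecMulVec u y)) :
    (1 + hat (vecMulVec c d + vecMulVec u x) * L) * θ (vecMulVec c d + vecMulVec u x) -
      hat (vecMulVec c d + vecMulVec u x) ∈ rowLine κ' (a u) := by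
  have hhat : ∀ x, hat (vecMulVec c d + vecMulVec u x) - hat (vecMulVec c d) =
      vecMulVec (a u) (b x) := fun x => by
    rw [map_add, hab u, add_sub_cancel_left]
  refine defect_mem_rowLine hZ (hhat x) ?_
  obtain ⟨u', -, hu'⟩ := h.row c d u hu
  obtain ⟨p, r, hp, hr, hpr⟩ := h.adj (vecMulVec c d) u y hu hy
  rw [← sub_eq_iff_eq_add'] at hpr
  have h1 := sub_mem_rowLine hZ hZy (hhat y)
  have h2 := hu' y
  rw [hpr] at h1 h2
  rw [rowLine_eq_of_mem (vecMulVec_ne_zero_of_ne hp hr) h1 h2]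
  exact hu' x

end Defect

theorem add_add_mem_sumsOfRankOne {k : ℕ} {W : Matrix ι κ D} (hW : W ∈ sumsOfRankOne k)
    (u v : ι → D) (x y : κ → D) : W + vecMulVec u x + vecMulVec v y ∈ sumsOfRankOne (k + 2) :=
  ⟨_, ⟨W, hW, u, x, rfl⟩, v, y, rfl⟩

/-- A sum of two matrices of rank at most one whose column or row spaces are comparable has rank at
most one. -/
theorem exists_vecMulVec_eq_add {u v : ι → D} {x y : κ → D}
    (h : ((∃ k, ∀ i, u i = v i * k) ∨ ∃ k : D, x = k • y) ∨
      (∃ k, ∀ i, v i = u i * k) ∨ ∃ k : D, y = k • x) :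
    ∃ w z, vecMulVec u x + vecMulVec v y = vecMulVec w z := by
  rcases h with (⟨k, hk⟩ | ⟨k, rfl⟩) | ⟨k, hk⟩ | ⟨k, rfl⟩
  · rw [funext hk, vecMulVec_mul_right_eq, ← vecMulVec_add]
    exact ⟨_, _, rfl⟩
  · rw [← vecMulVec_mul_right_eq, ← add_vecMulVec]
    exact ⟨_, _, rfl⟩
  · rw [funext hk, vecMulVec_mul_right_eq, ← vecMulVec_add]
    exact ⟨_, _, rfl⟩
  · rw [← vecMulVec_mul_right_eq, ← add_vecMulVec]
    exact ⟨_, _, rfl⟩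

theorem ne_zero_of_not_exists_mul {u v : ι → D} (h : ¬ ∃ k, ∀ i, u i = v i * k) : u ≠ 0 := by
  rintro rfl
  exact h ⟨0, fun i => by simp⟩

theorem ne_zero_of_not_exists_smul {x y : κ → D} (h : ¬ ∃ k : D, x = k • y) : x ≠ 0 := by
  rintro rfl
  exact h ⟨0, by simp⟩

/-- The fractional formula for a locally standard map holds if it holds in rank one. -/
theorem IsLocallyStandard.one_add_mul_eq [Fintype ι] [Fintype ι'] [Fintype κ'] [DecidableEq ι']
    [DecidableEq κ'] {θ : Matrix ι κ D → Matrix ι' κ' D'} {L : Matrix κ' ι' D'}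
    {hat : Matrix ι κ D →+ Matrix ι' κ' D'} {a : (ι → D) → ι' → D'} {b : (κ → D) → κ' → D'}
    (h : IsLocallyStandard θ) (h0 : θ 0 = 0)
    (hab : ∀ u x, hat (vecMulVec u x) = vecMulVec (a u) (b x))
    (ha : ∀ u v, (∃ k, ∀ i, a u i = a v i * k) → ∃ k, ∀ i, u i = v i * k)
    (hb : ∀ x y, (∃ k : D', b x = k • b y) → ∃ k : D, x = k • y)
    (h1 : ∀ u x, (1 + hat (vecMulVec u x) * L) * θ (vecMulVec u x) = hat (vecMulVec u x))
    (X : Matrix ι κ D) : (1 + hat X * L) * θ X = hat X := by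
  obtain ⟨k, hk⟩ := exists_mem_sumsOfRankOne X
  induction k using Nat.strong_induction_on generalizing X with
  | _ k ih =>
  match k, hk with
  | 0, hk =>
    obtain rfl : X = 0 := hk
    simp [h0]
  | 1, ⟨_, hZ, u, x, hX⟩ =>
    obtain rfl := hZ
    rw [hX, zero_add]
    exact h1 u x
  | 2, ⟨_, ⟨_, hZ, u, x, rfl⟩, v, y, hX⟩ =>
    obtain rfl := hZ
    rw [zero_add] at hX
    subst hX
    by_cases hpar : ((∃ k, ∀ i, u i = v i * k) ∨ ∃ k : D, x = k • y) ∨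
        (∃ k, ∀ i, v i = u i * k) ∨ ∃ k : D, y = k • x
    · obtain ⟨w, z, H⟩ := exists_vecMulVec_eq_add hpar
      rw [H]
      exact h1 w z
    rw [not_or, not_or, not_or] at hpar
    obtain ⟨⟨huv, hxy⟩, hvu, hyx⟩ := hpar
    rw [← sub_eq_zero]
    refine eq_zero_of_mem_rowLine (u := a u) (v := a v) ?_ ?_ fun H => huv (ha u v H)
    · rw [add_comm (vecMulVec u x)]
      refine h.defect_mem_rowLine_of_vecMulVec hab (ne_zero_of_not_exists_mul huv)
        (ne_zero_of_not_exists_smul hyx) (h1 v y) ?_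
      rw [← add_vecMulVec]
      exact h1 _ _
    · refine h.defect_mem_rowLine_of_vecMulVec hab (ne_zero_of_not_exists_mul hvu)
        (ne_zero_of_not_exists_smul hxy) (h1 u x) ?_
      rw [← add_vecMulVec]
      exact h1 _ _
  | k + 3, ⟨_, ⟨_, ⟨W, hW, u, x, rfl⟩, v, y, rfl⟩, w, z, hX⟩ =>
    have ih' : ∀ u v x y, (1 + hat (W + vecMulVec u x + vecMulVec v y) * L) *
        θ (W + vecMulVec u x + vecMulVec v y) = hat (W + vecMulVec u x + vecMulVec v y) :=
      fun u v x y => ih (k + 2) (by omega) _ (add_add_mem_sumsOfRankOne hW u v x y)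
    by_cases hpar : ((∃ k, ∀ i, u i = v i * k) ∨ ∃ k : D, x = k • y) ∨
        (∃ k, ∀ i, v i = u i * k) ∨ ∃ k : D, y = k • x
    · obtain ⟨p, q, H⟩ := exists_vecMulVec_eq_add hpar
      rw [hX, add_assoc W, H]
      exact ih' _ _ _ _
    by_cases hpar₁ : ((∃ k, ∀ i, v i = w i * k) ∨ ∃ k : D, y = k • z) ∨
        (∃ k, ∀ i, w i = v i * k) ∨ ∃ k : D, z = k • y
    · obtain ⟨p, q, H⟩ := exists_vecMulVec_eq_add hpar₁
      rw [hX, add_assoc (W + _), H]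
      exact ih' _ _ _ _
    by_cases hpar₂ : ((∃ k, ∀ i, u i = w i * k) ∨ ∃ k : D, x = k • z) ∨
        (∃ k, ∀ i, w i = u i * k) ∨ ∃ k : D, z = k • x
    · obtain ⟨p, q, H⟩ := exists_vecMulVec_eq_add hpar₂
      rw [hX, add_right_comm, add_assoc W, H]
      exact ih' _ _ _ _
    rw [not_or, not_or, not_or] at hpar hpar₁ hpar₂
    obtain ⟨⟨huv, hxy⟩, hvu, hyx⟩ := hpar
    obtain ⟨⟨-, hyz⟩, -, hzy⟩ := hpar₁
    obtain ⟨⟨-, hxz⟩, -, -⟩ := hpar₂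
    have hne : ∀ {x y : κ → D}, (¬ ∃ k : D, x = k • y) → x ≠ y := fun H H' =>
      H ⟨1, by rw [one_smul, H']⟩
    rw [hX, ← sub_eq_zero]
    refine eq_zero_of_mem_rowLine (u := a u) (v := a v) ?_ ?_ fun H => huv (ha u v H)
    · rw [show W + vecMulVec u x + vecMulVec v y + vecMulVec w z =
        W + vecMulVec v y + vecMulVec w z + vecMulVec u x by abel]
      refine h.defect_mem_rowLine_of_two hab hb (ne_zero_of_not_exists_mul huv)
        (ne_zero_of_not_exists_smul hxy) (ne_zero_of_not_exists_smul hyx)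
        (ne_zero_of_not_exists_smul hzy) (hne hxy) (hne hxz) hyz (ih' _ _ _ _) ?_ ?_
      · rw [show W + vecMulVec v y + vecMulVec w z + vecMulVec u y =
          W + vecMulVec (v + u) y + vecMulVec w z by rw [add_vecMulVec]; abel]
        exact ih' _ _ _ _
      · rw [add_assoc (W + _), ← add_vecMulVec]
        exact ih' _ _ _ _
    · rw [add_right_comm]
      refine h.defect_mem_rowLine_of_two hab hb (ne_zero_of_not_exists_mul hvu)
        (ne_zero_of_not_exists_smul hyx) (ne_zero_of_not_exists_smul hxy)
        (ne_zero_of_not_exists_smul hzy) (hne hyx) (hne hyz) hxz (ih' _ _ _ _) ?_ ?_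
      · rw [show W + vecMulVec u x + vecMulVec w z + vecMulVec v x =
          W + vecMulVec (u + v) x + vecMulVec w z by rw [add_vecMulVec]; abel]
        exact ih' _ _ _ _
      · rw [add_assoc (W + _), ← add_vecMulVec]
        exact ih' _ _ _ _

end RankInduction

section Formula

variable {D D' : Type*} [DivisionRing D] [DivisionRing D'] {ι κ ι' κ' : Type*}

theorem map_vecMulVec (τ : D →+* D') (u : ι → D) (x : κ → D) :
    (vecMulVec u x).map τ = vecMulVec (τ ∘ u) (τ ∘ x) := by
  ext i j
  simp [vecMulVec_apply]

theorem exists_eq_mul_of_comp (τ : D →+* D') {u v : ι → D} {k : D'}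
    (h : ∀ i, τ (u i) = τ (v i) * k) : ∃ k, ∀ i, u i = v i * k := by
  by_cases hv : v = 0
  · exact ⟨0, fun i => τ.injective (by simpa [hv] using h i)⟩
  obtain ⟨i, hi⟩ := Function.ne_iff.1 hv
  refine ⟨(v i)⁻¹ * u i, fun j => τ.injective ?_⟩
  rw [h, map_mul, map_mul, h, map_inv₀, inv_mul_cancel_left₀ ((map_ne_zero τ).2 hi)]

theorem exists_eq_smul_of_comp (τ : D →+* D') {x y : κ → D} {k : D'}
    (h : ∀ j, τ (x j) = k * τ (y j)) : ∃ k : D, x = k • y := by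
  by_cases hy : y = 0
  · exact ⟨0, funext fun i => τ.injective (by simpa [hy] using h i)⟩
  obtain ⟨i, hi⟩ := Function.ne_iff.1 hy
  refine ⟨x i * (y i)⁻¹, funext fun j => τ.injective ?_⟩
  rw [h, Pi.smul_apply, smul_eq_mul, map_mul, map_mul, h, map_inv₀,
    mul_inv_cancel_right₀ ((map_ne_zero τ).2 hi)]

/-- The fractional formula in rank one extends to all matrices. -/
theorem IsLocallyStandard.eq_mul_inverse_mul [Fintype ι] [Fintype κ] [Fintype ι'] [Fintype κ']
    [DecidableEq ι] [DecidableEq κ] [DecidableEq ι'] [DecidableEq κ']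
    {θ : Matrix ι κ D → Matrix ι' κ' D'} (h : IsLocallyStandard θ) (h0 : θ 0 = 0) {τ : D →+* D'}
    {L : Matrix κ ι D'} {E : Matrix ι' ι D'} {E' : Matrix ι ι' D'} {F : Matrix κ κ' D'}
    {F' : Matrix κ' κ D'} (hE : E' * E = 1) (hF : F * F' = 1)
    (hθ : ∀ u x, 1 + (τ ∘ x) ⬝ᵥ (L *ᵥ (τ ∘ u)) ≠ 0 ∧ θ (vecMulVec u x) =
      vecMulVec (E *ᵥ (τ ∘ u)) ((1 + (τ ∘ x) ⬝ᵥ (L *ᵥ (τ ∘ u)))⁻¹ • ((τ ∘ x) ᵥ* F)))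
    (X : Matrix ι κ D) : IsUnit (1 + X.map τ * L) ∧
      θ X = E * (Ring.inverse (1 + X.map τ * L) * X.map τ) * F := by
  let hat : Matrix ι κ D →+ Matrix ι' κ' D' :=
    { toFun := fun X => E * X.map τ * F
      map_zero' := by simp
      map_add' := fun X Y => by
        rw [Matrix.map_add _ (map_add τ), Matrix.mul_add, Matrix.add_mul] }
  have hhat : ∀ X, hat X = E * X.map τ * F := fun _ => rfl
  have hab : ∀ u x, hat (vecMulVec u x) = vecMulVec (E *ᵥ (τ ∘ u)) ((τ ∘ x) ᵥ* F) := fun u x => by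
    rw [hhat, map_vecMulVec, mul_vecMulVec, vecMulVec_mul]
  have hE' : ∀ v, E' *ᵥ (E *ᵥ v) = v := fun v => by rw [mulVec_mulVec, hE, one_mulVec]
  have hF' : ∀ v, (v ᵥ* F) ᵥ* F' = v := fun v => by rw [vecMul_vecMul, hF, vecMul_one]
  have key : (1 + hat X * (F' * L * E')) * θ X = hat X := by
    refine h.one_add_mul_eq h0 hab ?_ ?_ ?_ X
    · rintro u v ⟨k, hk⟩
      refine exists_eq_mul_of_comp τ (k := k) fun i => ?_
      have h1 : E *ᵥ (τ ∘ u) = MulOpposite.op k • (E *ᵥ (τ ∘ v)) := funext hk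
      have h2 := congrArg (E' *ᵥ ·) h1
      simp only [mulVec_smul, hE'] at h2
      exact congrFun h2 i
    · rintro x y ⟨k, hk⟩
      refine exists_eq_smul_of_comp τ (k := k) fun i => ?_
      have h2 := congrArg (· ᵥ* F') hk
      simp only [smul_vecMul, hF'] at h2
      exact congrFun h2 i
    · intro u x
      obtain ⟨h1, h2⟩ := hθ u x
      have h3 : ((τ ∘ x) ᵥ* F) ᵥ* (F' * L * E') ⬝ᵥ (E *ᵥ (τ ∘ u)) =
          (τ ∘ x) ⬝ᵥ (L *ᵥ (τ ∘ u)) := by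
        rw [← vecMul_vecMul, ← vecMul_vecMul, hF', ← dotProduct_mulVec, hE', ← dotProduct_mulVec]
      rw [hab, h2, vecMulVec_mul, Matrix.add_mul, Matrix.one_mul, vecMulVec_mul_vecMulVec, h3,
        smul_smul, ← vecMulVec_add, ← add_smul, ← one_add_mul, mul_inv_cancel₀ h1, one_smul]
  have hXL : hat X * (F' * L * E') = E * (X.map τ * L) * E' := by
    rw [hhat]
    simp only [Matrix.mul_assoc]
    rw [← Matrix.mul_assoc F F', hF, Matrix.one_mul]
  have hright := one_add_mul_one_sub key
  have h1 : (1 + X.map τ * L) * E' = E' * (1 + hat X * (F' * L * E')) := by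
    rw [hXL, Matrix.mul_add, Matrix.add_mul, Matrix.one_mul, Matrix.mul_one, ← Matrix.mul_assoc E',
      ← Matrix.mul_assoc E', hE, Matrix.one_mul]
  have h2 : E * (1 + X.map τ * L) = (1 + hat X * (F' * L * E')) * E := by
    rw [hXL, Matrix.mul_add, Matrix.add_mul, Matrix.one_mul, Matrix.mul_one,
      Matrix.mul_assoc (E * (X.map τ * L)), hE, Matrix.mul_one]
  have hunit : IsUnit (1 + X.map τ * L) := by
    refine IsUnit.of_mul_eq_one (E' * (1 - θ X * (F' * L * E')) * E) ?_
    rw [← Matrix.mul_assoc, ← Matrix.mul_assoc, h1, Matrix.mul_assoc E', hright, Matrix.mul_one, hE]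
  refine ⟨hunit, ?_⟩
  have h3 : (1 - θ X * (F' * L * E')) * E = E * Ring.inverse (1 + X.map τ * L) := by
    have h4 := congrArg (fun M => (1 - θ X * (F' * L * E')) * M * Ring.inverse (1 + X.map τ * L)) h2
    rw [← Matrix.mul_assoc (1 - θ X * (F' * L * E')) (1 + _), one_sub_mul_one_add key,
      Matrix.one_mul, Matrix.mul_assoc, Matrix.mul_assoc E, Ring.mul_inverse_cancel _ hunit,
      Matrix.mul_one] at h4
    exact h4
  rw [← one_sub_mul_of_one_add_mul key, hhat, ← Matrix.mul_assoc, ← Matrix.mul_assoc, h3,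
    Matrix.mul_assoc E]

end Formula

section RankOfMatrices

theorem exists_ne_ne_ne_of_four_le_mk {α : Type} (h : (4 : Cardinal) ≤ Cardinal.mk α) (a b c : α) :
    ∃ d, d ≠ a ∧ d ≠ b ∧ d ≠ c := by
  by_contra! hd
  have hs : Function.Surjective ![a, b, c] := by
    intro d
    by_cases h1 : d = a
    · exact ⟨0, by simp [h1]⟩
    by_cases h2 : d = b
    · exact ⟨1, by simp [h2]⟩
    · exact ⟨2, by simp [hd d h1 h2]⟩
  have h3 := h.trans (Cardinal.mk_le_of_surjective hs)
  norm_num at h3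

variable {R : Type} [DivisionRing R] {m n m' n' : ℕ}

theorem mrank_le_one_iff {A : Matrix (Fin m) (Fin n) R} :
    mrank A ≤ 1 ↔ ∃ u x, A = vecMulVec u x := by
  rw [mrank, Submodule.finrank_le_one_iff_isPrincipal]
  constructor
  · rintro ⟨x, hx⟩
    have h : ∀ i, ∃ c : R, c • x = A i := fun i =>
      Submodule.mem_span_singleton.1 (hx ▸ Submodule.subset_span ⟨i, rfl⟩)
    choose u hu using h
    exact ⟨u, x, by ext i j; rw [← hu]; rfl⟩
  · rintro ⟨u, x, rfl⟩
    rw [← Submodule.finrank_le_one_iff_isPrincipal]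
    refine (Submodule.finrank_mono (t := Submodule.span R {x}) ?_).trans ?_
    · rw [Submodule.span_le]
      rintro _ ⟨i, rfl⟩
      exact Submodule.mem_span_singleton.2 ⟨u i, rfl⟩
    · simpa using finrank_span_le_card ({x} : Set (Fin n → R))

theorem mrank_eq_zero_iff {A : Matrix (Fin m) (Fin n) R} : mrank A = 0 ↔ A = 0 := by
  rw [mrank, Submodule.finrank_eq_zero, Submodule.span_eq_bot]
  constructor
  · intro h
    ext i j
    exact congrFun (h _ ⟨i, rfl⟩) j
  · rintro rfl _ ⟨i, rfl⟩
    rfl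

theorem mrank_eq_one_iff {A : Matrix (Fin m) (Fin n) R} :
    mrank A = 1 ↔ ∃ u x, u ≠ 0 ∧ x ≠ 0 ∧ A = vecMulVec u x := by
  constructor
  · intro h
    obtain ⟨u, x, rfl⟩ := mrank_le_one_iff.1 h.le
    have h0 : vecMulVec u x ≠ 0 := fun h0 => by simp [mrank_eq_zero_iff.2 h0] at h
    refine ⟨u, x, ?_, ?_, rfl⟩ <;> rintro rfl <;> exact h0 (by ext; simp [vecMulVec_apply])
  · rintro ⟨u, x, hu, hx, rfl⟩
    have h1 : mrank (vecMulVec u x) ≤ 1 := mrank_le_one_iff.2 ⟨u, x, rfl⟩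
    have h0 : mrank (vecMulVec u x) ≠ 0 :=
      fun h0 => vecMulVec_ne_zero_of_ne hu hx (mrank_eq_zero_iff.1 h0)
    omega

theorem isUnit_one_add_vecMulVec {ι : Type*} [Fintype ι] [DecidableEq ι] {f g : ι → R}
    (h : 1 + f ⬝ᵥ g ≠ 0) : IsUnit (1 + vecMulVec g f) := by
  refine IsUnit.of_mul_eq_one (1 - vecMulVec g ((1 + f ⬝ᵥ g)⁻¹ • f)) ?_
  have h1 : vecMulVec g f * vecMulVec g ((1 + f ⬝ᵥ g)⁻¹ • f) =
      vecMulVec g ((f ⬝ᵥ g) • (1 + f ⬝ᵥ g)⁻¹ • f) := by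
    rw [vecMulVec_mul_vecMulVec]
  have h2 : vecMulVec g ((1 + f ⬝ᵥ g)⁻¹ • f) + vecMulVec g ((f ⬝ᵥ g) • (1 + f ⬝ᵥ g)⁻¹ • f) =
      vecMulVec g f := by
    rw [← vecMulVec_add, smul_smul, ← add_smul, ← one_add_mul, mul_inv_cancel₀ h, one_smul]
  rw [mul_sub, mul_one, add_mul, one_mul, h1, h2, add_sub_cancel_right]

/-- A functional `f` such that adding to the identity the rank-one matrices of `u - e` and `f`
gives invertible matrices sending the basis vector `e` to `u`. -/
theorem exists_one_add_dotProduct_ne_zero {ι : Type*} [Fintype ι] [DecidableEq ι] (i₀ : ι)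
    {u : ι → R} (hu : u ≠ 0) :
    ∃ f : ι → R, f i₀ = 1 ∧ 1 + f ⬝ᵥ (u - Pi.single i₀ 1) ≠ 0 ∧
      1 + (u - Pi.single i₀ 1) ⬝ᵥ f ≠ 0 := by
  by_cases h : u i₀ = 0
  · obtain ⟨i, hi⟩ := Function.ne_iff.1 hu
    have hne : i ≠ i₀ := by rintro rfl; exact hi h
    refine ⟨Pi.single i₀ 1 + Pi.single i 1, by simp [hne], ?_, ?_⟩
    · simpa [add_dotProduct, h, hne] using hi
    · simpa [dotProduct_add, h, hne] using hi
  · exact ⟨Pi.single i₀ 1, by simp, by simpa using h, by simpa using h⟩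

theorem isTypeOne_setOf_sub_mem_rowLine (hm : 0 < m) {u : Fin m → R} (hu : u ≠ 0)
    (B : Matrix (Fin m) (Fin n) R) : IsTypeOne {Y | Y - B ∈ rowLine (Fin n) u} := by
  obtain ⟨f, hf, hfu, -⟩ := exists_one_add_dotProduct_ne_zero ⟨0, hm⟩ hu
  refine ⟨_, B, isUnit_one_add_vecMulVec hfu, ?_⟩
  have key : ∀ r : Fin n → R,
      (1 + vecMulVec (u - Pi.single ⟨0, hm⟩ 1) f : Matrix (Fin m) (Fin m) R) *
      vecMulVec (Pi.single ⟨0, hm⟩ 1 : Fin m → R) r = vecMulVec u r := by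
    intro r
    rw [Matrix.add_mul, Matrix.one_mul, vecMulVec_mul_vecMulVec, dotProduct_single, hf, one_mul,
      one_smul, ← add_vecMulVec, add_sub_cancel]
  ext Y
  constructor
  · rintro ⟨r, hr⟩
    refine ⟨vecMulVec (Pi.single ⟨0, hm⟩ 1) r, fun i j hi => ?_, ?_⟩
    · have : i ≠ ⟨0, hm⟩ := fun h => hi (congrArg Fin.val h)
      simp [vecMulVec_apply, this]
    · simp only [key, ← hr, sub_add_cancel]
  · rintro ⟨X, hX, rfl⟩
    have hX' : X = vecMulVec (Pi.single ⟨0, hm⟩ 1) (X ⟨0, hm⟩) := by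
      ext i j
      by_cases hi : i = ⟨0, hm⟩
      · simp [vecMulVec_apply, hi]
      · rw [hX i j fun h => hi (Fin.ext h)]
        simp [vecMulVec_apply, hi]
    refine ⟨X ⟨0, hm⟩, ?_⟩
    rw [add_sub_cancel_right, ← key, ← hX']

theorem isTypeTwo_setOf_sub_mem_colLine (hn : 0 < n) {x : Fin n → R} (hx : x ≠ 0)
    (B : Matrix (Fin m) (Fin n) R) : IsTypeTwo {Y | Y - B ∈ colLine (Fin m) x} := by
  obtain ⟨f, hf, -, hfx⟩ := exists_one_add_dotProduct_ne_zero ⟨0, hn⟩ hx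
  refine ⟨_, B, isUnit_one_add_vecMulVec hfx, ?_⟩
  have key : ∀ c : Fin m → R, vecMulVec c (Pi.single ⟨0, hn⟩ 1 : Fin n → R) *
      (1 + vecMulVec f (x - Pi.single ⟨0, hn⟩ 1) : Matrix (Fin n) (Fin n) R) = vecMulVec c x := by
    intro c
    rw [Matrix.mul_add, Matrix.mul_one, vecMulVec_mul_vecMulVec, single_dotProduct, hf, one_mul,
      one_smul, ← vecMulVec_add, add_sub_cancel]
  ext Y
  constructor
  · rintro ⟨c, hc⟩
    refine ⟨vecMulVec c (Pi.single ⟨0, hn⟩ 1), fun i j hj => ?_, ?_⟩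
    · have : j ≠ ⟨0, hn⟩ := fun h => hj (congrArg Fin.val h)
      simp [vecMulVec_apply, this]
    · simp only [key, ← hc, sub_add_cancel]
  · rintro ⟨X, hX, rfl⟩
    have hX' : X = vecMulVec (fun i => X i ⟨0, hn⟩) (Pi.single ⟨0, hn⟩ 1) := by
      ext i j
      by_cases hj : j = ⟨0, hn⟩
      · simp [vecMulVec_apply, hj]
      · rw [hX i j fun h => hj (Fin.ext h)]
        simp [vecMulVec_apply, hj]
    refine ⟨fun i => X i ⟨0, hn⟩, ?_⟩
    rw [add_sub_cancel_right, ← key, ← hX']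

theorem isUnit_diagonal_of_ne_zero {ι : Type*} [Fintype ι] [DecidableEq ι] {d : ι → R}
    (h : ∀ i, d i ≠ 0) : IsUnit (diagonal d) := by
  refine IsUnit.of_mul_eq_one (diagonal fun i => (d i)⁻¹) ?_
  rw [diagonal_mul_diagonal, ← diagonal_one]
  exact congrArg _ (funext fun i => mul_inv_cancel₀ (h i))

/-- The extension by one of a family indexed by an initial segment. -/
def extendOne (c : Fin m → R) (i' : Fin m') : R :=
  if h : i'.val < m then c ⟨i', h⟩ else 1

theorem extendOne_ne_zero {c : Fin m → R} (hc : ∀ i, c i ≠ 0) (i' : Fin m') :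
    extendOne c i' ≠ 0 := by
  rw [extendOne]
  split_ifs
  exacts [hc _, one_ne_zero]

theorem diagonal_mul_embedM_mul_diagonal (hm : m ≤ m') (hn : n ≤ n') (c : Fin m → R)
    (q : Fin n → R) (Y : Matrix (Fin m) (Fin n) R) :
    (diagonal (extendOne c) : Matrix (Fin m') (Fin m') R) *
        (embedM Y : Matrix (Fin m') (Fin n') R) *
        (diagonal (extendOne q) : Matrix (Fin n') (Fin n') R) =
      scaledEmbedding (Fin.castLE hm) c * Y * (scaledEmbedding (Fin.castLE hn) q)ᵀ := by
  ext i' j'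
  rw [mul_diagonal, diagonal_mul, mul_apply]
  simp only [mul_apply, transpose_apply, scaledEmbedding, of_apply, Pi.single_apply, ite_mul,
    mul_ite, zero_mul, mul_zero]
  by_cases hi : i'.val < m
  · have hi' : ∀ i, i' = Fin.castLE hm i ↔ (⟨i', hi⟩ : Fin m) = i := fun i => by
      simp [Fin.ext_iff]
    by_cases hj : j'.val < n
    · have hj' : ∀ j, j' = Fin.castLE hn j ↔ (⟨j', hj⟩ : Fin n) = j := fun j => by
        simp [Fin.ext_iff]
      simp [hi', hj', embedM, extendOne, hi, hj]
    · have hj' : ∀ j, j' ≠ Fin.castLE hn j := fun j h => hj (by simp [h])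
      simp [hj', embedM, hj]
  · have hi' : ∀ i, i' ≠ Fin.castLE hm i := fun i h => hi (by simp [h])
    simp [hi', embedM, hi]

variable {D D' : Type} [DivisionRing D] [DivisionRing D']
  {θ : Matrix (Fin m) (Fin n) D → Matrix (Fin m') (Fin n') D'}

theorem exists_not_mem_of_not_degenerate (hm' : 0 < m') (hn' : 0 < n') (hnd : ¬ Degenerate θ)
    (a : Fin m → D) (b : Fin n → D) {u' : Fin m' → D'} {x' : Fin n' → D'} (hu' : u' ≠ 0)
    (hx' : x' ≠ 0) : ∃ u x, u ≠ 0 ∧ x ≠ 0 ∧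
      θ (vecMulVec a b + vecMulVec u x) - θ (vecMulVec a b) ∉ rowLine (Fin n') u' ∧
      θ (vecMulVec a b + vecMulVec u x) - θ (vecMulVec a b) ∉ colLine (Fin m') x' := by
  by_contra! h
  have hrow : θ (vecMulVec a b) - θ (vecMulVec a b) ∈ rowLine (Fin n') u' :=
    ⟨0, by rw [sub_self, vecMulVec_zero_right]⟩
  have hcol : θ (vecMulVec a b) - θ (vecMulVec a b) ∈ colLine (Fin m') x' :=
    ⟨0, by ext; simp [vecMulVec_apply]⟩
  refine hnd ⟨vecMulVec a b, mrank_le_one_iff.2 ⟨a, b, rfl⟩, _, _,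
    isTypeOne_setOf_sub_mem_rowLine hm' hu' (θ (vecMulVec a b)),
    isTypeTwo_setOf_sub_mem_colLine hn' hx' (θ (vecMulVec a b)), ⟨hrow, hcol⟩, ?_⟩
  rintro _ ⟨X, hX, rfl⟩
  obtain ⟨u, x, hux⟩ := mrank_le_one_iff.1 hX
  obtain rfl : X = vecMulVec a b + vecMulVec u x := by rw [← hux, add_sub_cancel]
  rcases eq_or_ne u 0 with rfl | hu
  · have : vecMulVec a b + vecMulVec 0 x = vecMulVec a b := by ext; simp [vecMulVec_apply]
    rw [this]
    exact Or.inl hrow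
  rcases eq_or_ne x 0 with rfl | hx
  · have : vecMulVec a b + vecMulVec u 0 = vecMulVec a b := by rw [vecMulVec_zero_right, add_zero]
    rw [this]
    exact Or.inl hrow
  exact or_iff_not_imp_left.2 fun h1 => h u x hu hx h1

theorem mem_rowLine_single_of_rowSet {i : Fin m} {i' : Fin m'}
    (h : θ '' rowSet D m n i ⊆ rowSet D' m' n' i') (x : Fin n → D) :
    θ (vecMulVec (Pi.single i 1) x) ∈ rowLine (Fin n') (Pi.single i' 1) := by
  have hmem := h ⟨vecMulVec (Pi.single i 1) x, fun a j ha => by simp [vecMulVec_apply, ha], rfl⟩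
  refine ⟨θ (vecMulVec (Pi.single i 1) x) i', ?_⟩
  ext a j
  by_cases ha : a = i'
  · simp [vecMulVec_apply, ha]
  · rw [hmem a j ha]
    simp [vecMulVec_apply, ha]

theorem mem_colLine_single_of_colSet {j : Fin n} {j' : Fin n'}
    (h : θ '' colSet D m n j ⊆ colSet D' m' n' j') (u : Fin m → D) :
    θ (vecMulVec u (Pi.single j 1)) ∈ colLine (Fin m') (Pi.single j' 1) := by
  have hmem := h ⟨vecMulVec u (Pi.single j 1), fun i b hb => by simp [vecMulVec_apply, hb], rfl⟩
  refine ⟨fun i => θ (vecMulVec u (Pi.single j 1)) i j', ?_⟩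
  ext i b
  by_cases hb : b = j'
  · simp [vecMulVec_apply, hb]
  · rw [hmem i b hb]
    simp [vecMulVec_apply, hb]

theorem eq_zero_of_surjective {τ : D →+* D'} (hτ : Function.Surjective τ)
    {L : Matrix (Fin n) (Fin m) D'}
    (h : ∀ (u : Fin m → D) (x : Fin n → D), 1 + (τ ∘ x) ⬝ᵥ (L *ᵥ (τ ∘ u)) ≠ 0) : L = 0 := by
  ext j i
  by_contra hL
  rw [Matrix.zero_apply] at hL
  obtain ⟨μ, hμ⟩ := hτ (-(L j i)⁻¹)
  have hu : τ ∘ (Pi.single i 1 : Fin m → D) = Pi.single i 1 := by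
    ext a
    by_cases ha : a = i <;> simp [ha]
  have hx : τ ∘ (Pi.single j μ : Fin n → D) = Pi.single j (-(L j i)⁻¹) := by
    ext a
    by_cases ha : a = j <;> simp [ha, hμ]
  refine h (Pi.single i 1) (Pi.single j μ) ?_
  rw [hu, hx, mulVec_single_one, single_dotProduct, col_apply, neg_mul, inv_mul_cancel₀ hL,
    add_neg_cancel]

end RankOfMatrices

/-- Proposition 5.3. -/
theorem main_proposition_hom_case
    {D D' : Type} [DivisionRing D] [DivisionRing D']
    (hD : (4 : Cardinal) ≤ Cardinal.mk D)
    {m n m' n' : ℕ} (hm2 : 2 ≤ m) (hn2 : 2 ≤ n) (hm'2 : 2 ≤ m') (hn'2 : 2 ≤ n')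
    (hm : m ≤ m') (hn : n ≤ n')
    (θ : Matrix (Fin m) (Fin n) D → Matrix (Fin m') (Fin n') D')
    (hhom : ∀ X Y, mrank (X - Y) = 1 → mrank (θ X - θ Y) = 1)
    (hnd : ¬ Degenerate θ) (h0 : θ 0 = 0)
    (hrow : ∀ i : Fin m, θ '' rowSet D m n i ⊆ rowSet D' m' n' (Fin.castLE hm i))
    (hcol : ∀ j : Fin n, θ '' colSet D m n j ⊆ colSet D' m' n' (Fin.castLE hn j)) :
    ∃ P : Matrix (Fin m') (Fin m') D', ∃ Q : Matrix (Fin n') (Fin n') D',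
      IsUnit P ∧ IsUnit Q ∧ P.IsDiag ∧ Q.IsDiag ∧
      ∃ τ : D →+* D', ∃ L : Matrix (Fin n) (Fin m) D',
        (∀ X : Matrix (Fin m) (Fin n) D, IsUnit (1 + X.map τ * L)) ∧
        (∀ X : Matrix (Fin m) (Fin n) D,
          θ X = P * (embedM (Ring.inverse (1 + X.map τ * L) * X.map τ) :
            Matrix (Fin m') (Fin n') D') * Q) ∧
        (Function.Surjective τ → L = 0 ∧ Function.Bijective τ) := by
  have hD3 := exists_ne_ne_ne_of_four_le_mk hD
  have : Nontrivial (Fin m) := Fin.nontrivial_iff_two_le.2 hm2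
  have : Nontrivial (Fin n) := Fin.nontrivial_iff_two_le.2 hn2
  have : Nontrivial (Fin m') := Fin.nontrivial_iff_two_le.2 hm'2
  have : Nontrivial (Fin n') := Fin.nontrivial_iff_two_le.2 hn'2
  have hadj : ∀ A u x, u ≠ 0 → x ≠ 0 →
      ∃ u' x', u' ≠ 0 ∧ x' ≠ 0 ∧ θ (A + vecMulVec u x) = θ A + vecMulVec u' x' := by
    intro A u x hu hx
    obtain ⟨u', x', hu', hx', h⟩ := mrank_eq_one_iff.1 (hhom (A + vecMulVec u x) A
      (mrank_eq_one_iff.2 ⟨u, x, hu, hx, add_sub_cancel_left _ _⟩))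
    exact ⟨u', x', hu', hx', by rw [← h, add_sub_cancel]⟩
  have hrow' i := mem_rowLine_single_of_rowSet (hrow i)
  have hcol' j := mem_colLine_single_of_colSet (hcol j)
  let i₀ : Fin m := ⟨0, by omega⟩
  have hθ : IsLocallyStandard θ := isLocallyStandard_of_nondegenerate hadj
    (fun a b u' x' hu' hx' =>
      exists_not_mem_of_not_degenerate (by omega) (by omega) hnd a b hu' hx') h0
    (u₀ := Pi.single i₀ 1) (by simp) ⟨_, by simp, hrow' i₀⟩
  obtain ⟨τ, c, q, L, hc, hq, hτ⟩ := hθ.exists_formula_vecMulVec hD3 h0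
    (Fin.castLE_injective hm) (Fin.castLE_injective hn) hrow' hcol'
  have key := hθ.eq_mul_inverse_mul h0
    (scaledEmbedding_mul_left (Fin.castLE_injective hm) hc)
    (mul_scaledEmbedding_transpose (Fin.castLE_injective hn) hq) hτ
  refine ⟨diagonal (extendOne c), diagonal (extendOne q),
    isUnit_diagonal_of_ne_zero (extendOne_ne_zero hc),
    isUnit_diagonal_of_ne_zero (extendOne_ne_zero hq), isDiag_diagonal _, isDiag_diagonal _,
    τ, L, fun X => (key X).1, fun X => ?_, fun hs =>
      ⟨eq_zero_of_surjective hs fun u x => (hτ u x).1, τ.injective, hs⟩⟩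
  rw [(key X).2, diagonal_mul_embedM_mul_diagonal hm hn]
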